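/- arXiv:1405.5369 — 2 statements merged into one kernel-verified Lean document; each statement's English description precedes it below -/
import Mathlib

section
/- Let d ≥ 2 and let π_j : ℝ^d → ℝ^{d-1} denote the linear projection deleting the j-th coordinate. There exist ε > 0 and a constant C, depending only on d, with the following property: for each j = 1, …, d let 𝒜_j be a finite index set and for each α ∈ 𝒜_j let f_α : ℝ^{d-1} → [0,∞] be integrable and let L_α : ℝ^d → ℝ^{d-1} be a linear map with ‖L_α − π_j‖ ≤ ε. Then ∫_{ℝ^d} ∏_{j=1}^d ( ∑_{α ∈ 𝒜_j} f_α ∘ L_α )^{1/(d-1)} ≤ C ∏_{j=1}^d ( ∑_{α ∈ 𝒜_j} ∫_{ℝ^{d-1}} f_α )^{1/(d-1)}. -/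
open MeasureTheory
open scoped ENNReal

/-- The projection `ℝ^{n+1} → ℝ^n` deleting the `j`-th coordinate, as a continuous
linear map between euclidean spaces. -/
noncomputable def coordProj (n : ℕ) (j : Fin (n + 1)) :
    EuclideanSpace ℝ (Fin (n + 1)) →L[ℝ] EuclideanSpace ℝ (Fin n) :=
  (PiLp.continuousLinearEquiv 2 ℝ (fun _ : Fin n => ℝ)).symm.toContinuousLinearMap.comp
    (ContinuousLinearMap.pi fun i => EuclideanSpace.proj (j.succAbove i))

open Filter Topology Set
open scoped RealInnerProductSpace NNReal

section Legendre

variable {E : Type*} [NormedAddCommGroup E] [InnerProductSpace ℝ E] {K : Set E}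

/-- The Legendre transform of a function given on the set `K`. -/
noncomputable def legendreOn (u : C(K, ℝ)) (y : E) : ℝ := ⨆ x : K, (⟪(x : E), y⟫ - u x)

variable [Nonempty K] in
theorem legendreOn_le {u : C(K, ℝ)} {y : E} {c : ℝ} (h : ∀ x : K, ⟪(x : E), y⟫ - u x ≤ c) :
    legendreOn u y ≤ c := ciSup_le h

variable [CompactSpace K]

theorem le_legendreOn (u : C(K, ℝ)) (x : K) (y : E) : ⟪(x : E), y⟫ - u x ≤ legendreOn u y := by
  refine le_ciSup (f := fun x : K => ⟪(x : E), y⟫ - u x) ?_ x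
  exact (isCompact_range (by fun_prop)).bddAbove

variable [Nonempty K]

theorem exists_legendreOn_eq (u : C(K, ℝ)) (y : E) :
    ∃ x : K, legendreOn u y = ⟪(x : E), y⟫ - u x := by
  have hc : Continuous fun x : K => ⟪(x : E), y⟫ - u x := by fun_prop
  obtain ⟨x, -, hx⟩ := isCompact_univ.exists_isMaxOn (univ_nonempty (α := K)) hc.continuousOn
  exact ⟨x, le_antisymm (ciSup_le fun z => hx (mem_univ z)) (le_legendreOn u x y)⟩

theorem legendreOn_le_add_of_le {u v : C(K, ℝ)} {c : ℝ} (h : ∀ x, v x ≤ u x + c) (y : E) :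
    legendreOn u y ≤ legendreOn v y + c :=
  legendreOn_le fun x => by linarith [h x, le_legendreOn v x y]

theorem legendreOn_le_add_norm {C : ℝ≥0} (hC : ∀ x ∈ K, ‖x‖ ≤ C) (u : C(K, ℝ)) (y y' : E) :
    legendreOn u y ≤ legendreOn u y' + C * ‖y - y'‖ := by
  refine legendreOn_le fun x => ?_
  have h1 := le_legendreOn u x y'
  have h2 : ⟪(x : E), y - y'⟫ ≤ C * ‖y - y'‖ :=
    (real_inner_le_norm _ _).trans (mul_le_mul_of_nonneg_right (hC x x.2) (norm_nonneg _))
  rw [inner_sub_right] at h2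
  linarith

theorem lipschitzWith_legendreOn {C : ℝ≥0} (hC : ∀ x ∈ K, ‖x‖ ≤ C) (u : C(K, ℝ)) :
    LipschitzWith C (legendreOn u) :=
  LipschitzWith.of_le_add_mul C fun y y' => by
    rw [dist_eq_norm]; exact legendreOn_le_add_norm hC u y y'

theorem convexOn_legendreOn (u : C(K, ℝ)) :
    ConvexOn ℝ univ (legendreOn u) := by
  refine ⟨convex_univ, fun y _ z _ a b ha hb hab => legendreOn_le fun x => ?_⟩
  have h1 := mul_le_mul_of_nonneg_left (le_legendreOn u x y) ha
  have h2 := mul_le_mul_of_nonneg_left (le_legendreOn u x z) hb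
  rw [inner_add_right, real_inner_smul_right, real_inner_smul_right]
  simp only [smul_eq_mul]
  have : u x = a * u x + b * u x := by rw [← add_mul, hab, one_mul]
  linarith

end Legendre

section Kantorovich

variable {E : Type*} [NormedAddCommGroup E] [InnerProductSpace ℝ E]
  [MeasurableSpace E] [BorelSpace E] {K Y : Set E} [CompactSpace K] [CompactSpace Y] [Nonempty K]
  (ν : Measure K) (μ : Measure E)

/-- The dual Kantorovich functional for the cost `-⟪x, y⟫`. -/
noncomputable def kantorovich (Y : Set E) (u : C(K, ℝ)) : ℝ :=
  ∫ x, u x ∂ν + ∫ y in Y, legendreOn u y ∂μ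

omit [CompactSpace Y] [MeasurableSpace E] [BorelSpace E] in
theorem continuous_legendreOn (u : C(K, ℝ)) : Continuous (legendreOn u) := by
  obtain ⟨C, hC⟩ := (isCompact_iff_compactSpace.2 ‹CompactSpace K›).isBounded.exists_norm_le
  have hC' : ∀ x ∈ K, ‖x‖ ≤ C.toNNReal := fun x hx => (hC x hx).trans (Real.le_coe_toNNReal C)
  exact (lipschitzWith_legendreOn hC' u).continuous

theorem integrableOn_legendreOn [IsFiniteMeasureOnCompacts μ] (u : C(K, ℝ)) :
    IntegrableOn (legendreOn u) Y μ :=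
  (continuous_legendreOn u).continuousOn.integrableOn_compact
    (isCompact_iff_compactSpace.2 ‹CompactSpace Y›)

omit [InnerProductSpace ℝ E] [Nonempty K] in
theorem ContinuousMap.integrable_of_compactSpace [IsFiniteMeasure ν] (u : C(K, ℝ)) :
    Integrable u ν :=
  (BoundedContinuousFunction.mkOfCompact u).integrable ν

theorem kantorovich_le_add [IsFiniteMeasureOnCompacts μ] [IsFiniteMeasure ν]
    {u v : C(K, ℝ)} {a b : ℝ} (h1 : ∀ x, u x ≤ v x + a)
    (h2 : ∀ y ∈ Y, legendreOn u y ≤ legendreOn v y + b) :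
    kantorovich ν μ Y u ≤ kantorovich ν μ Y v + (a * ν.real univ + b * μ.real Y) := by
  have hY : IsCompact Y := isCompact_iff_compactSpace.2 ‹CompactSpace Y›
  have e1 : ∫ x, u x ∂ν ≤ ∫ x, (v x + a) ∂ν :=
    integral_mono (u.integrable_of_compactSpace ν)
      ((v.integrable_of_compactSpace ν).add (integrable_const a)) h1
  have e2 : ∫ y in Y, legendreOn u y ∂μ ≤ ∫ y in Y, (legendreOn v y + b) ∂μ :=
    setIntegral_mono_on (integrableOn_legendreOn μ u)
      ((integrableOn_legendreOn μ v).add (integrableOn_const hY.measure_lt_top.ne))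
      hY.measurableSet h2
  rw [integral_add (v.integrable_of_compactSpace ν) (integrable_const a)] at e1
  rw [integral_add (integrableOn_legendreOn μ v) (integrableOn_const hY.measure_lt_top.ne)] at e2
  simp only [integral_const, smul_eq_mul, measureReal_restrict_apply_univ] at e1 e2
  unfold kantorovich
  linarith

theorem continuous_kantorovich [IsFiniteMeasureOnCompacts μ] [IsFiniteMeasure ν] :
    Continuous (kantorovich (K := K) ν μ Y) := by
  have h : LipschitzWith (ν.real univ + μ.real Y).toNNReal (kantorovich (K := K) ν μ Y) := by
    refine LipschitzWith.of_le_add_mul _ fun u v => ?_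
    have huv : ∀ x, |u x - v x| ≤ dist u v := fun x => by
      rw [← Real.dist_eq]; exact ContinuousMap.dist_apply_le_dist x
    refine (kantorovich_le_add ν μ (u := u) (v := v) (a := dist u v) (b := dist u v) (fun x => ?_)
      fun y _ => legendreOn_le_add_of_le (fun x => ?_) y).trans_eq ?_
    · linarith [le_abs_self (u x - v x), huv x]
    · linarith [neg_abs_le (u x - v x), huv x]
    · rw [Real.coe_toNNReal _ (by positivity)]; ring
  exact h.continuous

omit [InnerProductSpace ℝ E] [MeasurableSpace E] [BorelSpace E] [CompactSpace K] [CompactSpace Y]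
  [Nonempty K] in
theorem isCompact_setOf_lipschitzWith (R : ℝ≥0) (x₀ : K) :
    IsCompact {u : C(K, ℝ) | LipschitzWith R u ∧ u x₀ = 0} := by
  refine ArzelaAscoli.isCompact_of_equicontinuous _ ?_ ?_
  · have hpi : IsCompact (Set.pi univ fun x : K => Metric.closedBall (0 : ℝ) (R * dist x x₀)) :=
      isCompact_univ_pi fun _ => isCompact_closedBall _ _
    refine hpi.of_isClosed_subset ?_ ?_
    · have : ContinuousMap.toFun '' {u : C(K, ℝ) | LipschitzWith R u ∧ u x₀ = 0} =
          {f : K → ℝ | LipschitzWith R f ∧ f x₀ = 0} := by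
        ext f
        constructor
        · rintro ⟨u, hu, rfl⟩; exact hu
        · intro hf; exact ⟨⟨f, hf.1.continuous⟩, hf, rfl⟩
      rw [this]
      have h1 : IsClosed {f : K → ℝ | LipschitzWith R f} := by
        simp only [lipschitzWith_iff_dist_le_mul, ofPred_forall]
        exact isClosed_iInter fun x => isClosed_iInter fun y =>
          isClosed_le (by fun_prop) continuous_const
      exact h1.inter (isClosed_eq (continuous_apply x₀) continuous_const)
    · rintro _ ⟨u, hu, rfl⟩ x -
      have := hu.1.dist_le_mul x x₀
      rw [hu.2] at this
      exact this
  · exact (LipschitzWith.uniformEquicontinuous _ R fun u => u.2.1).equicontinuous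

theorem exists_forall_kantorovich_le [Nonempty Y] [IsFiniteMeasureOnCompacts μ] [IsFiniteMeasure ν]
    (h : ν univ = μ Y) :
    ∃ u : C(K, ℝ), ∀ v : C(K, ℝ), kantorovich ν μ Y u ≤ kantorovich ν μ Y v := by
  obtain ⟨x₀⟩ := ‹Nonempty K›
  have : Nonempty K := ⟨x₀⟩
  obtain ⟨C, hC⟩ := (isCompact_iff_compactSpace.2 ‹CompactSpace Y›).isBounded.exists_norm_le
  have hC' : ∀ y ∈ Y, ‖y‖ ≤ C.toNNReal := fun x hx => (hC x hx).trans (Real.le_coe_toNNReal C)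
  obtain ⟨u, -, hu⟩ := (isCompact_setOf_lipschitzWith C.toNNReal x₀).exists_isMinOn
    ⟨0, LipschitzWith.const' (0 : ℝ), rfl⟩
    (continuous_kantorovich ν μ (Y := Y)).continuousOn
  refine ⟨u, fun v => ?_⟩
  set w : C(Y, ℝ) := ⟨fun y => legendreOn v y, (continuous_legendreOn v).comp continuous_subtype_val⟩
  have hlip : LipschitzWith C.toNNReal fun x : K => legendreOn w x - legendreOn w x₀ := by
    refine LipschitzWith.of_le_add_mul _ fun x y => ?_
    have := legendreOn_le_add_norm hC' w x y
    rw [Subtype.dist_eq, dist_eq_norm]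
    linarith
  set v' : C(K, ℝ) := ⟨fun x : K => legendreOn w x - legendreOn w x₀, hlip.continuous⟩
  have hv' : v' ∈ {u : C(K, ℝ) | LipschitzWith C.toNNReal u ∧ u x₀ = 0} := ⟨hlip, sub_self _⟩
  refine (hu hv').trans ?_
  refine (kantorovich_le_add ν μ (u := v') (v := v) (a := - legendreOn w x₀)
    (b := legendreOn w x₀) (fun x => ?_) fun y hy => legendreOn_le fun x => ?_).trans_eq ?_
  · have : legendreOn w x ≤ v x := legendreOn_le fun y => by
      have := le_legendreOn v x y
      rw [real_inner_comm]
      change _ - legendreOn v y ≤ _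
      linarith
    change legendreOn w x - legendreOn w x₀ ≤ _
    linarith
  · have := le_legendreOn w ⟨y, hy⟩ x
    rw [real_inner_comm] at this
    change _ - legendreOn v y ≤ _ at this
    change _ - (legendreOn w x - legendreOn w x₀) ≤ _
    linarith
  · simp [Measure.real, h]

end Kantorovich

section Brenier

variable {E : Type*} [NormedAddCommGroup E] [InnerProductSpace ℝ E]

theorem HasGradientAt.exists_norm_sub_le [CompleteSpace E] {w : E → ℝ} {g y : E}
    (hw : HasGradientAt w g y) {ε : ℝ} (hε : 0 < ε) :
    ∃ δ > 0, ∀ x, (∀ z, w y + ⟪x, z - y⟫ - δ ≤ w z) → ‖x - g‖ ≤ ε := by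
  have h1 := (hasGradientAt_iff_isLittleO.1 hw).def (half_pos hε)
  obtain ⟨s, hs, hball⟩ := Metric.nhds_basis_closedBall.eventually_iff.1 h1
  refine ⟨s * (ε / 2), by positivity, fun x hx => ?_⟩
  by_contra! hlt
  have hpos : 0 < ‖x - g‖ := hε.trans hlt
  set h : E := (s / ‖x - g‖) • (x - g)
  have hh : ‖h‖ = s := by
    rw [norm_smul, Real.norm_of_nonneg (by positivity), div_mul_cancel₀ _ hpos.ne']
  have h2 := hball (x := y + h) (by simp [hh])
  have h3 := hx (y + h)
  have h4 : ⟪x - g, h⟫ = s * ‖x - g‖ := by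
    rw [real_inner_smul_right, real_inner_self_eq_norm_sq]
    field_simp
  rw [add_sub_cancel_left, hh, Real.norm_eq_abs] at h2
  rw [add_sub_cancel_left] at h3
  rw [inner_sub_left] at h4
  have h5 := le_abs_self (w (y + h) - w y - ⟪g, h⟫)
  have h6 : s * ‖x - g‖ ≤ s * ε := by linarith
  exact absurd (le_of_mul_le_mul_left h6 hs) (not_le.2 hlt)

theorem HasGradientAt.eq_of_forall_le [CompleteSpace E] {w : E → ℝ} {g y x : E}
    (hw : HasGradientAt w g y) (hx : ∀ z, w y + ⟪x, z - y⟫ ≤ w z) : x = g := by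
  refine eq_of_norm_sub_le_zero (le_of_forall_pos_le_add fun ε hε => ?_)
  obtain ⟨δ, hδ, h⟩ := hw.exists_norm_sub_le hε
  rw [zero_add]
  exact h x fun z => by linarith [hx z]

variable {K : Set E} [CompactSpace K] [Nonempty K]

omit [Nonempty K] in
theorem legendreOn_add_inner_le {u : C(K, ℝ)} {x : K} {y : E}
    (hx : legendreOn u y = ⟪(x : E), y⟫ - u x) (z : E) :
    legendreOn u y + ⟪(x : E), z - y⟫ ≤ legendreOn u z := by
  have := le_legendreOn u x z
  rw [inner_sub_right]
  linarith

theorem tendsto_slope_legendreOn [CompleteSpace E] (u φ : C(K, ℝ)) (ψ : C(E, ℝ))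
    (hφ : ∀ x : K, φ x = ψ x) {y : E} (hy : DifferentiableAt ℝ (legendreOn u) y) :
    Tendsto (fun t : ℝ => (legendreOn (u + t • φ) y - legendreOn u y) / t) (𝓝[>] 0)
      (𝓝 (-ψ (gradient (legendreOn u) y))) := by
  have hg := hy.hasGradientAt
  set g := gradient (legendreOn u) y
  choose X hX using fun t : ℝ => exists_legendreOn_eq (u + t • φ) y
  have hpt : ∀ x, |φ x| ≤ ‖φ‖ := fun x => φ.norm_coe_le_norm x
  have hXlim : Tendsto (fun t => (X t : E)) (𝓝[>] 0) (𝓝 g) := by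
    rw [Metric.tendsto_nhds]
    intro ε hε
    obtain ⟨δ, hδ, h⟩ := hg.exists_norm_sub_le (half_pos hε)
    have hsm : ∀ᶠ t : ℝ in 𝓝[>] 0, 2 * (t * ‖φ‖) < δ := by
      have : Tendsto (fun t : ℝ => 2 * (t * ‖φ‖)) (𝓝[>] 0) (𝓝 (2 * (0 * ‖φ‖))) :=
        (Continuous.tendsto (by fun_prop) 0).mono_left nhdsWithin_le_nhds
      refine this.eventually (gt_mem_nhds ?_)
      simpa using hδ
    filter_upwards [hsm, self_mem_nhdsWithin] with t ht ht0
    have ht0 : 0 < t := ht0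
    rw [dist_eq_norm]
    refine (h _ fun z => ?_).trans_lt (half_lt_self hε)
    have h1 := legendreOn_add_inner_le (hX t) z
    have hb : ∀ x, |t * φ x| ≤ t * ‖φ‖ := fun x => by
      rw [abs_mul, abs_of_pos ht0]; exact mul_le_mul_of_nonneg_left (hpt x) ht0.le
    have h2 : legendreOn u y ≤ legendreOn (u + t • φ) y + t * ‖φ‖ :=
      legendreOn_le_add_of_le (fun x => by
        simpa using (le_abs_self _).trans (hb x)) y
    have h3 : legendreOn (u + t • φ) z ≤ legendreOn u z + t * ‖φ‖ :=
      legendreOn_le_add_of_le (fun x => by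
        have := neg_abs_le (t * φ x)
        simp
        linarith [hb x]) z
    linarith
  obtain ⟨x₀, hx₀⟩ := exists_legendreOn_eq u y
  have hx₀g : (x₀ : E) = g := hg.eq_of_forall_le (legendreOn_add_inner_le hx₀)
  refine tendsto_of_tendsto_of_tendsto_of_le_of_le' tendsto_const_nhds
    ((ψ.continuous.tendsto g).comp hXlim).neg ?_ ?_
  · filter_upwards [self_mem_nhdsWithin] with t (ht : 0 < t)
    rw [le_div_iff₀ ht, ← hx₀g, ← hφ]
    have := le_legendreOn (u + t • φ) x₀ y
    simp at this
    linarith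
  · filter_upwards [self_mem_nhdsWithin] with t (ht : 0 < t)
    rw [div_le_iff₀ ht, Function.comp, ← hφ]
    have := le_legendreOn u (X t) y
    have h2 := hX t
    simp at h2
    linarith

variable [MeasurableSpace E] [BorelSpace E]

theorem measurable_gradient [CompleteSpace E] (w : E → ℝ) : Measurable (gradient w) := by
  unfold gradient
  exact (InnerProductSpace.toDual ℝ E).symm.continuous.measurable.comp (measurable_fderiv ℝ w)

variable [FiniteDimensional ℝ E]

/-- Brenier's theorem for compactly supported measures: a convex Lipschitz function whose gradient
pushes Haar measure on `Y` forward to `ν`. -/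
theorem exists_map_gradient_eq {K Y : Set E} (hK : IsCompact K) (hKne : K.Nonempty)
    (hY : IsCompact Y) (hYne : Y.Nonempty) (μ : Measure E) [μ.IsAddHaarMeasure] (ν : Measure E)
    (hν : ν univ = μ Y) (hνK : ν Kᶜ = 0) :
    ∃ w : E → ℝ, ConvexOn ℝ univ w ∧ (∃ C, LipschitzWith C w) ∧
      (μ.restrict Y).map (gradient w) = ν := by
  have := isCompact_iff_compactSpace.1 hK
  have := isCompact_iff_compactSpace.1 hY
  have := hKne.to_subtype
  have := hYne.to_subtype
  have hνfin : IsFiniteMeasure ν := ⟨hν ▸ hY.measure_lt_top⟩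
  have hme : MeasurableEmbedding ((↑) : K → E) := .subtype_coe hK.measurableSet
  set ν' : Measure K := ν.comap (↑)
  have hmap : ν'.map (↑) = ν := by
    rw [hme.map_comap, Subtype.range_coe]
    exact Measure.restrict_eq_self_of_ae_mem (mem_ae_iff.2 hνK)
  have hν' : ν' univ = μ Y := by
    rw [← hν, ← hmap, hme.map_apply, preimage_univ]
  have : IsFiniteMeasure ν' := ⟨hν' ▸ hY.measure_lt_top⟩
  obtain ⟨u, hu⟩ := exists_forall_kantorovich_le ν' μ (Y := Y) hν'
  obtain ⟨C, hC⟩ := hK.isBounded.exists_norm_le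
  have hC' : ∀ x ∈ K, ‖x‖ ≤ C.toNNReal := fun x hx => (hC x hx).trans (Real.le_coe_toNNReal C)
  have hlip := lipschitzWith_legendreOn hC' u
  refine ⟨legendreOn u, convexOn_legendreOn u, ⟨_, hlip⟩, ?_⟩
  have : IsFiniteMeasure (μ.restrict Y) := ⟨by simpa using hY.measure_lt_top⟩
  have hgrad := measurable_gradient (legendreOn u)
  have key : ∀ ψ : BoundedContinuousFunction E ℝ,
      ∫ y in Y, ψ (gradient (legendreOn u) y) ∂μ ≤ ∫ x, ψ x ∂ν := by
    intro ψ
    set φ : C(K, ℝ) := ψ.toContinuousMap.restrict K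
    have hφ : ∀ x : K, φ x = ψ x := fun x => rfl
    have hpt : ∀ x, |φ x| ≤ ‖φ‖ := fun x => φ.norm_coe_le_norm x
    set t : ℕ → ℝ := fun k => 1 / ((k : ℝ) + 1)
    have ht0 : ∀ k, 0 < t k := fun k => by positivity
    have htlim : Tendsto t atTop (𝓝[>] 0) :=
      tendsto_nhdsWithin_iff.2 ⟨tendsto_one_div_add_atTop_nhds_zero_nat, .of_forall ht0⟩
    have hlim : Tendsto (fun k => ∫ y in Y, (legendreOn (u + t k • φ) y - legendreOn u y) / t k ∂μ)
        atTop (𝓝 (∫ y in Y, -ψ (gradient (legendreOn u) y) ∂μ)) := by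
      refine tendsto_integral_of_dominated_convergence (fun _ => ‖φ‖) (fun k => ?_)
        (integrable_const _) (fun k => .of_forall fun y => ?_) ?_
      · exact (((continuous_legendreOn _).sub
          (continuous_legendreOn _)).div_const _).aestronglyMeasurable
      · rw [Real.norm_eq_abs, abs_div, abs_of_pos (ht0 k), div_le_iff₀ (ht0 k), abs_le]
        have hb : ∀ x, |t k * φ x| ≤ ‖φ‖ * t k := fun x => by
          rw [abs_mul, abs_of_pos (ht0 k), mul_comm]
          exact mul_le_mul_of_nonneg_right (hpt x) (ht0 k).le
        have h2 : legendreOn u y ≤ legendreOn (u + t k • φ) y + ‖φ‖ * t k :=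
          legendreOn_le_add_of_le (fun x => by simpa using (le_abs_self _).trans (hb x)) y
        have h3 : legendreOn (u + t k • φ) y ≤ legendreOn u y + ‖φ‖ * t k :=
          legendreOn_le_add_of_le (fun x => by
            have := neg_abs_le (t k * φ x)
            simp
            linarith [hb x]) y
        constructor <;> linarith
      · filter_upwards [ae_restrict_of_ae (hlip.ae_differentiableAt (μ := μ))] with y hy
        exact (tendsto_slope_legendreOn u φ ψ.toContinuousMap hφ hy).comp htlim
    have hle : ∀ k, -∫ x, φ x ∂ν' ≤
        ∫ y in Y, (legendreOn (u + t k • φ) y - legendreOn u y) / t k ∂μ := by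
      intro k
      have h1 := hu (u + t k • φ)
      have e1 : ∫ x, (u + t k • φ) x ∂ν' = ∫ x, u x ∂ν' + t k * ∫ x, φ x ∂ν' := by
        simp only [ContinuousMap.add_apply, ContinuousMap.smul_apply, smul_eq_mul]
        rw [integral_add (u.integrable_of_compactSpace ν')
          ((φ.integrable_of_compactSpace ν').const_mul _), integral_const_mul]
      rw [integral_div, integral_sub (integrableOn_legendreOn μ _) (integrableOn_legendreOn μ _),
        le_div_iff₀ (ht0 k)]
      unfold kantorovich at h1
      linarith
    have h2 := ge_of_tendsto' hlim hle
    rw [integral_neg, neg_le_neg_iff] at h2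
    refine h2.trans_eq ?_
    rw [← hmap, hme.integral_map]
    rfl
  have : IsFiniteMeasure ((μ.restrict Y).map (gradient (legendreOn u))) :=
    Measure.isFiniteMeasure_map _ _
  refine ext_of_forall_integral_eq_of_IsFiniteMeasure fun ψ => ?_
  rw [integral_map hgrad.aemeasurable ψ.continuous.aestronglyMeasurable]
  refine le_antisymm (key ψ) ?_
  have := key (-ψ)
  simpa [integral_neg] using this

end Brenier

section Regularization

variable {E : Type*} [NormedAddCommGroup E] [InnerProductSpace ℝ E]

theorem ConvexOn.add_inner_gradient_le [CompleteSpace E] {w : E → ℝ} (hw : ConvexOn ℝ univ w)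
    {y : E} (hy : DifferentiableAt ℝ w y) (z : E) : w y + ⟪gradient w y, z - y⟫ ≤ w z := by
  have h1 := hy.hasGradientAt.hasFDerivAt.hasLineDerivAt (z - y)
  have h2 := hasDerivAt_iff_tendsto_slope_zero.1 h1
  have h3 := h2.mono_left (nhdsWithin_mono (0 : ℝ) (s := Ioi 0) fun t ht => (ne_of_gt ht : t ≠ 0))
  have h4 : ⟪gradient w y, z - y⟫ ≤ w z - w y := by
    refine le_of_tendsto h3 ?_
    filter_upwards [Ioo_mem_nhdsGT (zero_lt_one' ℝ)] with t ht
    have h5 := hw.2 (mem_univ y) (mem_univ z) (sub_nonneg.2 ht.2.le) ht.1.le (by ring)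
    have h6 : y + t • (z - y) = (1 - t) • y + t • z := by module
    simp only [zero_add, zero_smul, add_zero, smul_eq_mul] at h5 ⊢
    rw [h6, inv_mul_le_iff₀ ht.1]
    linarith
  linarith

/-- A cocoercive gradient map `S` into `Y` inverting the strongly monotone map `∇w + τ id`. -/
theorem ConvexOn.exists_regularized_gradient [CompleteSpace E] {w : E → ℝ}
    (hw : ConvexOn ℝ univ w)
    (hwc : Continuous w) {Y : Set E} (hY : IsCompact Y) (hYc : Convex ℝ Y) (hYne : Y.Nonempty)
    {τ : ℝ} (hτ : 0 < τ) :
    ∃ (S : E → E) (U : E → ℝ), (∀ x, S x ∈ Y) ∧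
      (∀ x x', τ * ‖S x - S x'‖ ^ 2 ≤ ⟪x - x', S x - S x'⟫) ∧
      (∀ x, HasGradientAt U (S x) x) ∧
      ∀ y ∈ Y, DifferentiableAt ℝ w y → S (gradient w y + τ • y) = y := by
  set Φ : E → E → ℝ := fun x y => ⟪x, y⟫ - w y - τ / 2 * ‖y‖ ^ 2
  have hex : ∀ x, ∃ m ∈ Y, ∀ y ∈ Y, Φ x y ≤ Φ x m := fun x => by
    obtain ⟨m, hm, hmax⟩ := hY.exists_isMaxOn hYne (f := Φ x) (by fun_prop)
    exact ⟨m, hm, fun y hy => hmax hy⟩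
  choose S hSY hS using hex
  have hgrow : ∀ x, ∀ y ∈ Y, Φ x y + τ / 2 * ‖y - S x‖ ^ 2 ≤ Φ x (S x) := by
    intro x y hy
    have hlim : Tendsto (fun s : ℝ => Φ x y + τ / 2 * ((1 - s) * ‖y - S x‖ ^ 2)) (𝓝[>] 0)
        (𝓝 (Φ x y + τ / 2 * ((1 - 0) * ‖y - S x‖ ^ 2))) :=
      (Continuous.tendsto (by fun_prop) 0).mono_left nhdsWithin_le_nhds
    rw [sub_zero, one_mul] at hlim
    refine le_of_tendsto hlim ?_
    filter_upwards [Ioo_mem_nhdsGT (zero_lt_one' ℝ)] with s hs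
    have h1 := hS x _ (hYc (hSY x) hy (sub_nonneg.2 hs.2.le) hs.1.le (by ring))
    have h2 := hw.2 (mem_univ (S x)) (mem_univ y) (sub_nonneg.2 hs.2.le) hs.1.le (by ring)
    have h3 : ‖(1 - s) • S x + s • y‖ ^ 2 =
        (1 - s) * ‖S x‖ ^ 2 + s * ‖y‖ ^ 2 - s * (1 - s) * ‖y - S x‖ ^ 2 := by
      rw [norm_add_sq_real, norm_sub_sq_real, norm_smul, norm_smul, real_inner_smul_left,
        real_inner_smul_right, real_inner_comm, mul_pow, mul_pow]
      simp only [Real.norm_eq_abs, sq_abs]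
      ring
    simp only [Φ] at h1 ⊢
    rw [h3, inner_add_right, real_inner_smul_right, real_inner_smul_right] at h1
    simp only [smul_eq_mul] at h2
    refine le_of_mul_le_mul_left ?_ hs.1
    linarith
  have hcross : ∀ x x' y, Φ x y - Φ x' y = ⟪x - x', y⟫ := fun x x' y => by
    simp only [Φ, inner_sub_left]; ring
  have hmono : ∀ x x', τ * ‖S x - S x'‖ ^ 2 ≤ ⟪x - x', S x - S x'⟫ := fun x x' => by
    have h1 := hgrow x (S x') (hSY x')
    have h2 := hgrow x' (S x) (hSY x)
    have h3 := hcross x x' (S x)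
    have h4 := hcross x x' (S x')
    rw [norm_sub_rev] at h1
    rw [inner_sub_right]
    linarith
  refine ⟨S, fun x => Φ x (S x), hSY, hmono, fun x => ?_, fun y hy hdiff => ?_⟩
  · refine hasGradientAt_iff_isLittleO.2 (Asymptotics.IsBigO.trans_isLittleO (g := fun x' =>
      ‖x' - x‖ ^ 2) (Asymptotics.IsBigO.of_bound (1 / τ) (.of_forall fun x' => ?_)) ?_)
    · have h1 := hS x' (S x) (hSY x)
      have h2 := hS x (S x') (hSY x')
      have h3 := hcross x' x (S x)
      have h4 := hcross x' x (S x')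
      have h5 := real_inner_le_norm (x' - x) (S x' - S x)
      have h6 := hmono x' x
      have h7 : ‖S x' - S x‖ ≤ ‖x' - x‖ / τ := by
        rw [le_div_iff₀ hτ]
        rcases (norm_nonneg (S x' - S x)).eq_or_lt with h0 | h0
        · rw [← h0, zero_mul]; positivity
        · refine le_of_mul_le_mul_right ?_ h0
          nlinarith
      have h8 : ⟪x' - x, S x' - S x⟫ ≤ 1 / τ * ‖x' - x‖ ^ 2 :=
        h5.trans ((mul_le_mul_of_nonneg_left h7 (norm_nonneg _)).trans_eq (by ring))
      rw [inner_sub_right] at h8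
      rw [real_inner_comm, Real.norm_eq_abs, abs_of_nonneg (by linarith), norm_pow, norm_norm]
      linarith
    · exact (Asymptotics.isLittleO_norm_pow_id one_lt_two).comp_tendsto
        (tendsto_sub_nhds_zero_iff.2 tendsto_id)
  · set x := gradient w y + τ • y with hx
    have h1 := hgrow x y hy
    have h2 := hw.add_inner_gradient_le hdiff (S x)
    have h3 : ⟪x, S x - y⟫ = ⟪gradient w y, S x - y⟫ + τ * ⟪y, S x - y⟫ := by
      rw [hx, inner_add_left, real_inner_smul_left]
    have h4 : ‖S x‖ ^ 2 = ‖y‖ ^ 2 + 2 * ⟪y, S x - y⟫ + ‖y - S x‖ ^ 2 := by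
      rw [norm_sub_rev y, ← norm_add_sq_real, add_sub_cancel]
    simp only [Φ] at h1
    rw [inner_sub_right x] at h3
    have h5 : τ * ‖y - S x‖ ^ 2 ≤ 0 := by rw [h4] at h1; linarith
    have h6 : ‖y - S x‖ ^ 2 ≤ 0 := nonpos_of_mul_nonpos_right h5 hτ
    exact (sub_eq_zero.1 (norm_eq_zero.1 (pow_eq_zero_iff two_ne_zero |>.1
      (le_antisymm h6 (sq_nonneg _))))).symm

end Regularization

section Hadamard

open Matrix

theorem Matrix.PosSemidef.det_le_prod_diag {ι : Type*} [Fintype ι] [DecidableEq ι]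
    {M : Matrix ι ι ℝ} (hM : M.PosSemidef) : M.det ≤ ∏ i, M i i := by
  by_cases h0 : M.det = 0
  · rw [h0]; exact Finset.prod_nonneg fun i _ => hM.diag_nonneg
  have hpd : M.PosDef := hM.posDef_iff_det_ne_zero.2 h0
  have hd : ∀ i, 0 < M i i := fun i => hpd.diag_pos
  set D : Matrix ι ι ℝ := diagonal fun i => (√(M i i))⁻¹
  have hN : (D * M * D).PosSemidef := by
    simpa [D, diagonal_conjTranspose] using hM.mul_mul_conjTranspose_same D
  have hNd : ∀ i, (D * M * D) i i = 1 := fun i => by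
    simp only [D, mul_diagonal, diagonal_mul]
    have : √(M i i) ≠ 0 := (Real.sqrt_pos.2 (hd i)).ne'
    field_simp
    exact (Real.sq_sqrt (hd i).le).symm
  have hdet : (D * M * D).det * ∏ i, M i i = M.det := by
    have h1 : (∏ i, (√(M i i))⁻¹) * (∏ i, (√(M i i))⁻¹) * ∏ i, M i i = 1 := by
      rw [← Finset.prod_mul_distrib, ← Finset.prod_mul_distrib]
      refine Finset.prod_eq_one fun i _ => ?_
      have : √(M i i) ≠ 0 := (Real.sqrt_pos.2 (hd i)).ne'
      field_simp
      exact (Real.sq_sqrt (hd i).le).symm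
    rw [det_mul, det_mul, det_diagonal]
    linear_combination M.det * h1
  have htr := hN.1.trace_eq_sum_eigenvalues
  rw [trace] at htr
  simp only [diag_apply, hNd, RCLike.ofReal_real_eq_id, id] at htr
  have hle : (D * M * D).det ≤ 1 := by
    rw [hN.1.det_eq_prod_eigenvalues]
    simp only [RCLike.ofReal_real_eq_id, id]
    calc ∏ i, hN.1.eigenvalues i ≤ ∏ i, Real.exp (hN.1.eigenvalues i - 1) :=
          Finset.prod_le_prod (fun i _ => hN.eigenvalues_nonneg i) fun i _ => by
            linarith [Real.add_one_le_exp (hN.1.eigenvalues i - 1)]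
      _ = 1 := by rw [← Real.exp_sum, Finset.sum_sub_distrib, ← htr, sub_self, Real.exp_zero]
  rw [← hdet]
  exact mul_le_of_le_one_left (Finset.prod_nonneg fun i _ => (hd i).le) hle

/-- Hadamard's inequality for a positive operator in an arbitrary system of vectors. -/
theorem ContinuousLinearMap.det_mul_sq_le_prod_inner {ι : Type*} [Fintype ι] [DecidableEq ι]
    (A : EuclideanSpace ℝ ι →L[ℝ] EuclideanSpace ℝ ι) (hs : ∀ x y, ⟪A x, y⟫ = ⟪A y, x⟫)
    (hp : ∀ x, 0 ≤ ⟪A x, x⟫) (v : ι → EuclideanSpace ℝ ι) :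
    0 ≤ A.det ∧ A.det * (Matrix.of fun i j => v j i).det ^ 2 ≤ ∏ j, ⟪A (v j), v j⟫ := by
  set B := (EuclideanSpace.basisFun ι ℝ).toBasis
  set M := LinearMap.toMatrix B B (A : EuclideanSpace ℝ ι →ₗ[ℝ] EuclideanSpace ℝ ι)
  have hdet : M.det = A.det := by
    rw [LinearMap.det_toMatrix]
  have hMv : ∀ x : EuclideanSpace ℝ ι, ∀ i, (M *ᵥ x.ofLp) i = A x i := fun x i => by
    have := congrFun (LinearMap.toMatrix_mulVec_repr B B
      (A : EuclideanSpace ℝ ι →ₗ[ℝ] EuclideanSpace ℝ ι) x) i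
    have hr : ⇑(B.repr x) = x.ofLp := by ext; simp [B]
    rw [hr] at this
    simpa [B] using this
  have hinner : ∀ x y : EuclideanSpace ℝ ι, y.ofLp ⬝ᵥ (M *ᵥ x.ofLp) = ⟪A x, y⟫ := fun x y => by
    simp only [dotProduct, hMv, PiLp.inner_apply]
    exact Finset.sum_congr rfl fun i _ => by simp
  have hsym : M.IsHermitian := by
    ext i j
    have h1 := hs (EuclideanSpace.single i 1) (EuclideanSpace.single j 1)
    rw [← hinner, ← hinner] at h1
    simpa using h1
  have hpsd : M.PosSemidef := by
    refine Matrix.PosSemidef.of_dotProduct_mulVec_nonneg hsym fun x => ?_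
    have := hp (WithLp.toLp 2 x)
    rw [← hinner] at this
    simpa using this
  refine ⟨hdet ▸ hpsd.det_nonneg, ?_⟩
  set V : Matrix ι ι ℝ := Matrix.of fun i j => v j i
  have h1 := (hpsd.conjTranspose_mul_mul_same V).det_le_prod_diag
  have hdiag : ∀ j, (Vᴴ * M * V) j j = ⟪A (v j), v j⟫ := fun j => by
    rw [← hinner, Matrix.mul_assoc, Matrix.mul_apply]
    simp [dotProduct, Matrix.mul_apply, mulVec, V]
  rw [det_mul, det_mul, hdet, det_conjTranspose] at h1
  simp only [hdiag, star_trivial] at h1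
  linarith

end Hadamard

section Derivative

variable {E : Type*} [NormedAddCommGroup E] [InnerProductSpace ℝ E] [CompleteSpace E]

theorem inner_fderiv_comm_of_hasGradientAt {U : E → ℝ} {S : E → E}
    (hU : ∀ x, HasGradientAt U (S x) x) {x : E} (hx : DifferentiableAt ℝ S x) (v v' : E) :
    ⟪fderiv ℝ S x v, v'⟫ = ⟪fderiv ℝ S x v', v⟫ := by
  have h1 : ∀ y, HasFDerivAt U (innerSL ℝ (S y)) y := fun y => hU y
  have h2 : HasFDerivAt (fun y => innerSL ℝ (S y)) ((innerSL ℝ).comp (fderiv ℝ S x)) x :=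
    (innerSL ℝ (E := E)).hasFDerivAt.comp x hx.hasFDerivAt
  exact second_derivative_symmetric h1 h2 v v'

omit [CompleteSpace E] in
theorem inner_fderiv_self_nonneg {S : E → E} (hS : ∀ x y, 0 ≤ ⟪x - y, S x - S y⟫) {x : E}
    (hx : DifferentiableAt ℝ S x) (v : E) : 0 ≤ ⟪fderiv ℝ S x v, v⟫ := by
  have h1 := hasDerivAt_iff_tendsto_slope_zero.1 (hx.hasFDerivAt.hasLineDerivAt v)
  have h2 := h1.mono_left (nhdsWithin_mono (0 : ℝ) (s := Ioi 0) fun t ht => (ne_of_gt ht : t ≠ 0))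
  refine ge_of_tendsto (h2.inner tendsto_const_nhds) ?_
  filter_upwards [self_mem_nhdsWithin] with t (ht : 0 < t)
  have h3 := hS (x + t • v) x
  rw [add_sub_cancel_left, real_inner_smul_left, real_inner_comm] at h3
  rw [real_inner_smul_left, zero_add, zero_smul, add_zero]
  exact mul_nonneg (inv_nonneg.2 ht.le) (nonneg_of_mul_nonneg_right h3 ht)

end Derivative

section Lines

theorem lintegral_inner_fderiv_line_le {E : Type*} [NormedAddCommGroup E] [InnerProductSpace ℝ E]
    [FiniteDimensional ℝ E] [MeasurableSpace E] [BorelSpace E] {S : E → E}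
    (hS : ∀ x y, 0 ≤ ⟪x - y, S x - S y⟫) {R : ℝ} (hR : ∀ x, ‖S x‖ ≤ R) (a v : E) :
    ∫⁻ t : ℝ, ENNReal.ofReal ⟪fderiv ℝ S (a + t • v) v, v⟫ ≤ ENNReal.ofReal (2 * R * ‖v‖) := by
  set s : Set ℝ := {t | DifferentiableAt ℝ S (a + t • v)}
  have hs : MeasurableSet s :=
    (measurableSet_of_differentiableAt ℝ S).preimage
      (by fun_prop : Continuous fun t : ℝ => a + t • v).measurable
  have h1 : ∫⁻ t : ℝ, ENNReal.ofReal ⟪fderiv ℝ S (a + t • v) v, v⟫ =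
      ∫⁻ t in s, ENNReal.ofReal ⟪fderiv ℝ S (a + t • v) v, v⟫ := by
    refine (setLIntegral_eq_of_support_subset fun t ht => ?_).symm
    by_contra hts
    exact ht (by simp [fderiv_zero_of_not_differentiableAt hts])
  have hder : ∀ t ∈ s, HasDerivWithinAt (fun t : ℝ => ⟪S (a + t • v), v⟫)
      ⟪fderiv ℝ S (a + t • v) v, v⟫ s t := fun t ht => by
    have h2 : HasDerivAt (fun t : ℝ => a + t • v) v t := by
      simpa using ((hasDerivAt_id t).smul_const v).const_add a
    have h3 := ht.hasFDerivAt.comp_hasDerivAt t h2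
    simpa using (h3.inner ℝ (hasDerivAt_const t v)).hasDerivWithinAt
  have hmono : MonotoneOn (fun t : ℝ => ⟪S (a + t • v), v⟫) s := fun t _ t' _ htt' => by
    rcases htt'.eq_or_lt with rfl | hlt
    · exact le_rfl
    have h2 := hS (a + t' • v) (a + t • v)
    rw [add_sub_add_left_eq_sub, ← sub_smul, real_inner_smul_left, real_inner_comm] at h2
    have h3 := nonneg_of_mul_nonneg_right h2 (sub_pos.2 hlt)
    rw [inner_sub_left] at h3
    exact sub_nonneg.1 h3
  rw [h1, lintegral_deriv_eq_volume_image_of_monotoneOn hs hder hmono]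
  refine (measure_mono (t := Icc (-(R * ‖v‖)) (R * ‖v‖)) ?_).trans_eq ?_
  · rintro _ ⟨t, -, rfl⟩
    exact abs_le.1 ((abs_real_inner_le_norm _ _).trans
      (mul_le_mul_of_nonneg_right (hR _) (norm_nonneg _)))
  · rw [Real.volume_Icc]; ring_nf

variable {n : ℕ}

theorem lintegral_eq_lintegral_insertNth (j : Fin (n + 1))
    {Φ : EuclideanSpace ℝ (Fin (n + 1)) → ℝ≥0∞} (hΦ : Measurable Φ) :
    ∫⁻ z, Φ z = ∫⁻ y : EuclideanSpace ℝ (Fin n), ∫⁻ t : ℝ,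
      Φ (WithLp.toLp 2 (j.insertNth t y.ofLp : Fin (n + 1) → ℝ)) := by
  have e1 := EuclideanSpace.volume_preserving_symm_measurableEquiv_toLp (Fin (n + 1))
  have e2 := volume_preserving_piFinSuccAbove (fun _ : Fin (n + 1) => ℝ) j
  have e3 := EuclideanSpace.volume_preserving_symm_measurableEquiv_toLp (Fin n)
  have m1 : Measurable fun p : ℝ × (Fin n → ℝ) =>
      Φ (WithLp.toLp 2 (j.insertNth p.1 p.2 : Fin (n + 1) → ℝ)) :=
    hΦ.comp ((MeasurableEquiv.toLp 2 (Fin (n + 1) → ℝ)).measurable.comp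
      (MeasurableEquiv.piFinSuccAbove (fun _ : Fin (n + 1) => ℝ) j).symm.measurable)
  have h1 := (e2.comp e1).lintegral_comp m1
  have h2 := e3.lintegral_comp (f := fun y : Fin n → ℝ => ∫⁻ t : ℝ,
      Φ (WithLp.toLp 2 (j.insertNth t y : Fin (n + 1) → ℝ))) m1.lintegral_prod_left
  rw [Measure.volume_eq_prod, lintegral_prod_symm _ m1.aemeasurable] at h1
  refine Eq.trans ?_ (h1.trans h2.symm)
  refine lintegral_congr fun z => ?_
  congr 1
  ext i
  simp [MeasurableEquiv.piFinSuccAbove, Fin.insertNthEquiv]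

theorem toLp_insertNth (j : Fin (n + 1)) (t : ℝ) (y : Fin n → ℝ) :
    WithLp.toLp 2 (j.insertNth t y : Fin (n + 1) → ℝ) =
      WithLp.toLp 2 (j.insertNth 0 y : Fin (n + 1) → ℝ) + t • EuclideanSpace.single j (1 : ℝ) := by
  ext i
  refine j.succAboveCases ?_ (fun k => ?_) i <;> simp

theorem lintegral_comp_mul_le {j : Fin (n + 1)}
    {L : EuclideanSpace ℝ (Fin (n + 1)) →L[ℝ] EuclideanSpace ℝ (Fin n)}
    {A : EuclideanSpace ℝ (Fin (n + 1)) ≃L[ℝ] EuclideanSpace ℝ (Fin (n + 1))}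
    (hA : ∀ z i, L (A.symm z) i = z (j.succAbove i))
    (hdet : (A : EuclideanSpace ℝ (Fin (n + 1)) →L[ℝ] EuclideanSpace ℝ (Fin (n + 1))).det ≠ 0)
    {f : EuclideanSpace ℝ (Fin n) → ℝ≥0∞} (hf : Measurable f)
    {q : EuclideanSpace ℝ (Fin (n + 1)) → ℝ≥0∞} (hq : Measurable q) {c : ℝ≥0∞}
    (hqc : ∀ a, ∫⁻ t : ℝ, q (a + t • A.symm (EuclideanSpace.single j 1)) ≤ c) :
    ∫⁻ x, f (L x) * q x ≤
      ENNReal.ofReal |(A : EuclideanSpace ℝ (Fin (n + 1)) →L[ℝ] _).det⁻¹| * c * ∫⁻ y, f y := by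
  have hmap : Measure.map A volume = ENNReal.ofReal
      |(A : EuclideanSpace ℝ (Fin (n + 1)) →L[ℝ] EuclideanSpace ℝ (Fin (n + 1))).det⁻¹| • volume :=
    Measure.map_linearMap_addHaar_eq_smul_addHaar volume hdet
  have hmeas : Measurable fun x => f (L x) * q x := (hf.comp L.measurable).mul hq
  have h1 : ∫⁻ x, f (L x) * q x = ENNReal.ofReal |(A : EuclideanSpace ℝ (Fin (n + 1)) →L[ℝ] _).det⁻¹|
      * ∫⁻ z, f (L (A.symm z)) * q (A.symm z) := by
    have hmeas' : Measurable fun z => f (L (A.symm z)) * q (A.symm z) :=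
      hmeas.comp A.symm.continuous.measurable
    rw [← smul_eq_mul, ← lintegral_smul_measure, ← hmap,
      lintegral_map hmeas' A.continuous.measurable]
    simp only [ContinuousLinearEquiv.symm_apply_apply]
  rw [h1, mul_assoc]
  gcongr
  rw [lintegral_eq_lintegral_insertNth j (by fun_prop), ← lintegral_const_mul _ hf]
  refine lintegral_mono fun y => ?_
  have h2 : ∀ t, L (A.symm (WithLp.toLp 2 (j.insertNth t y.ofLp : Fin (n + 1) → ℝ))) = y :=
    fun t => by ext i; rw [hA]; simp
  simp only [h2]
  have h3 : Measurable fun t => WithLp.toLp 2 (j.insertNth t y.ofLp : Fin (n + 1) → ℝ) := by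
    rw [funext fun t => toLp_insertNth j t y.ofLp]
    fun_prop
  have h4 : Measurable fun t =>
      q (A.symm (WithLp.toLp 2 (j.insertNth t y.ofLp : Fin (n + 1) → ℝ))) :=
    hq.comp (A.symm.continuous.measurable.comp h3)
  rw [lintegral_const_mul _ h4, mul_comm]
  refine mul_le_mul' ?_ le_rfl
  refine le_trans (le_of_eq ?_) (hqc (A.symm (WithLp.toLp 2 (j.insertNth 0 y.ofLp))))
  refine lintegral_congr fun t => ?_
  rw [toLp_insertNth, map_add, map_smul]

end Lines

section Directions

variable {n : ℕ}

/-- A right inverse of `coordProj n j`, inserting `0` as the `j`-th coordinate. -/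
noncomputable def coordEmb (n : ℕ) (j : Fin (n + 1)) :
    EuclideanSpace ℝ (Fin n) →L[ℝ] EuclideanSpace ℝ (Fin (n + 1)) :=
  LinearMap.toContinuousLinearMap
    { toFun := fun y => WithLp.toLp 2 (j.insertNth 0 y.ofLp : Fin (n + 1) → ℝ)
      map_add' := fun x y => by
        ext i
        refine j.succAboveCases ?_ (fun k => ?_) i <;> simp
      map_smul' := fun c y => by
        ext i
        refine j.succAboveCases ?_ (fun k => ?_) i <;> simp }

theorem coordEmb_apply_succAbove (j : Fin (n + 1)) (y : EuclideanSpace ℝ (Fin n)) (i : Fin n) :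
    coordEmb n j y (j.succAbove i) = y i := by
  simp [coordEmb]

theorem coordProj_apply (j : Fin (n + 1)) (x : EuclideanSpace ℝ (Fin (n + 1))) (i : Fin n) :
    coordProj n j x i = x (j.succAbove i) := by
  simp [coordProj]

/-- A map close to `coordProj n j` becomes `coordProj n j` after a linear change of variables close
to the identity. -/
theorem exists_straightening (j : Fin (n + 1)) {η : ℝ} (hη : 0 < η) :
    ∃ ε > 0, ∀ L : EuclideanSpace ℝ (Fin (n + 1)) →L[ℝ] EuclideanSpace ℝ (Fin n),
      ‖L - coordProj n j‖ ≤ ε →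
      ∃ A : EuclideanSpace ℝ (Fin (n + 1)) ≃L[ℝ] EuclideanSpace ℝ (Fin (n + 1)),
        1 / 2 ≤ (A : EuclideanSpace ℝ (Fin (n + 1)) →L[ℝ] EuclideanSpace ℝ (Fin (n + 1))).det ∧
        (∀ z i, L (A.symm z) i = z (j.succAbove i)) ∧
        ‖A.symm (EuclideanSpace.single j 1) - EuclideanSpace.single j 1‖ ≤ η := by
  have hdet : ∀ᶠ B : EuclideanSpace ℝ (Fin (n + 1)) →L[ℝ] EuclideanSpace ℝ (Fin (n + 1)) in
      𝓝 (ContinuousLinearMap.id ℝ _), 1 / 2 < B.det := by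
    refine (ContinuousLinearMap.continuous_det.tendsto _).eventually_const_lt ?_
    simp [ContinuousLinearMap.det]; norm_num
  obtain ⟨δ, hδ, hδdet⟩ := Metric.eventually_nhds_iff.1 hdet
  set δ' : ℝ := min (δ / 2) (min (1 / 2) (η / 2))
  have hδ'pos : 0 < δ' := by positivity
  have hδ'1 : δ' < δ := (min_le_left _ _).trans_lt (half_lt_self hδ)
  have hδ'2 : δ' ≤ 1 / 2 := (min_le_right _ _).trans (min_le_left _ _)
  have hδ'3 : δ' ≤ η / 2 := (min_le_right _ _).trans (min_le_right _ _)
  refine ⟨δ' / (‖coordEmb n j‖ + 1), by positivity, fun L hL => ?_⟩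
  set P := (coordEmb n j).comp (L - coordProj n j)
  have hP : ‖P‖ ≤ δ' := by
    refine (ContinuousLinearMap.opNorm_comp_le _ _).trans ?_
    calc ‖coordEmb n j‖ * ‖L - coordProj n j‖
        ≤ (‖coordEmb n j‖ + 1) * (δ' / (‖coordEmb n j‖ + 1)) := by gcongr; linarith
      _ = δ' := by field_simp
  set B := ContinuousLinearMap.id ℝ (EuclideanSpace ℝ (Fin (n + 1))) + P with hBdef
  have hB : 1 / 2 < B.det := hδdet (by
    rw [dist_eq_norm, hBdef, add_sub_cancel_left]
    exact hP.trans_lt hδ'1)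
  have hB0 : B.det ≠ 0 := by linarith
  set A := B.toContinuousLinearEquivOfDetNeZero hB0
  have hAB : ∀ x, A x = x + P x := fun x => rfl
  have hLA : ∀ x i, L x i = A x (j.succAbove i) := fun x i => by
    rw [hAB, PiLp.add_apply]
    simp only [P, ContinuousLinearMap.comp_apply, coordEmb_apply_succAbove,
      sub_apply, PiLp.sub_apply, coordProj_apply]
    ring
  refine ⟨A, hB.le, fun z i => by rw [hLA, A.apply_symm_apply], ?_⟩
  set e : EuclideanSpace ℝ (Fin (n + 1)) := EuclideanSpace.single j 1
  set v := A.symm e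
  have hv : v + P v = e := by rw [← hAB]; exact A.apply_symm_apply e
  have he : ‖e‖ = 1 := by simp [e]
  have h1 : ‖P v‖ ≤ δ' * ‖v‖ := (P.le_opNorm v).trans (by gcongr)
  have h2 : ‖v‖ ≤ 1 + ‖P v‖ := by
    rw [← he, ← hv]
    simpa using norm_sub_le (v + P v) (P v)
  have h3 : v - e = -P v := by rw [← hv]; abel
  rw [h3, norm_neg]
  have h4 : δ' * ‖v‖ ≤ 1 / 2 * ‖v‖ := by gcongr
  have h5 : ‖v‖ ≤ 2 := by linarith
  calc ‖P v‖ ≤ δ' * ‖v‖ := h1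
    _ ≤ η / 2 * 2 := by gcongr
    _ = η := by ring

theorem exists_half_le_det (n : ℕ) : ∃ η > 0, ∀ v : Fin n → EuclideanSpace ℝ (Fin n),
    (∀ j, ‖v j - EuclideanSpace.single j 1‖ ≤ η) →
      1 / 2 ≤ (Matrix.of fun i j => v j i).det := by
  have hc : Continuous fun v : Fin n → EuclideanSpace ℝ (Fin n) =>
      (Matrix.of fun i j => v j i).det := by
    refine Continuous.matrix_det ?_
    refine continuous_matrix fun i j => ?_
    simp only [Matrix.of_apply]
    fun_prop
  have h1 : (Matrix.of fun i j => (EuclideanSpace.single j (1 : ℝ) :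
      EuclideanSpace ℝ (Fin n)) i).det = 1 := by
    rw [← Matrix.det_one (n := Fin n)]
    congr 1
    ext i j
    simp [Matrix.one_apply]
  have h2 : ∀ᶠ v : Fin n → EuclideanSpace ℝ (Fin n) in
      𝓝 (fun j => EuclideanSpace.single j 1), 1 / 2 < (Matrix.of fun i j => v j i).det :=
    (hc.tendsto _).eventually_const_lt (by rw [h1]; norm_num)
  obtain ⟨δ, hδ, h3⟩ := Metric.eventually_nhds_iff.1 h2
  refine ⟨δ / 2, by positivity, fun v hv => (h3 ?_).le⟩
  refine ((dist_pi_le_iff (by positivity)).2 fun j => ?_).trans_lt (half_lt_self hδ)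
  rw [dist_eq_norm]
  exact hv j

end Directions

section Holder

variable {n : ℕ}

theorem inner_fderiv_comm_and_nonneg {E : Type*} [NormedAddCommGroup E] [InnerProductSpace ℝ E]
    [CompleteSpace E] {S : E → E} {U : E → ℝ} (hU : ∀ x, HasGradientAt U (S x) x)
    (hS : ∀ x y, 0 ≤ ⟪x - y, S x - S y⟫) (x : E) :
    (∀ v v', ⟪fderiv ℝ S x v, v'⟫ = ⟪fderiv ℝ S x v', v⟫) ∧ ∀ v, 0 ≤ ⟪fderiv ℝ S x v, v⟫ := by
  by_cases hx : DifferentiableAt ℝ S x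
  · exact ⟨fun v v' => inner_fderiv_comm_of_hasGradientAt hU hx v v',
      fun v => inner_fderiv_self_nonneg hS hx v⟩
  · simp [fderiv_zero_of_not_differentiableAt hx]

/-- The multilinear estimate for a bounded monotone gradient map `S`, obtained from the pointwise
determinant inequality, Hölder's inequality and the bound for `S` along lines. -/
theorem lintegral_prod_mul_det_le {m : Fin (n + 1) → ℕ}
    {f : (j : Fin (n + 1)) → Fin (m j) → EuclideanSpace ℝ (Fin n) → ℝ≥0∞}
    (hf : ∀ j α, Measurable (f j α))
    {L : (j : Fin (n + 1)) → Fin (m j) →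
      (EuclideanSpace ℝ (Fin (n + 1)) →L[ℝ] EuclideanSpace ℝ (Fin n))}
    {A : (j : Fin (n + 1)) → Fin (m j) →
      (EuclideanSpace ℝ (Fin (n + 1)) ≃L[ℝ] EuclideanSpace ℝ (Fin (n + 1)))}
    (hA : ∀ j α z i, L j α ((A j α).symm z) i = z (j.succAbove i))
    (hdet : ∀ j α, 1 / 2 ≤
      (A j α : EuclideanSpace ℝ (Fin (n + 1)) →L[ℝ] EuclideanSpace ℝ (Fin (n + 1))).det)
    (hnorm : ∀ j α, ‖(A j α).symm (EuclideanSpace.single j 1)‖ ≤ 2)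
    (htrans : ∀ κ : (j : Fin (n + 1)) → Fin (m j), 1 / 2 ≤
      (Matrix.of fun i j => (A j (κ j)).symm (EuclideanSpace.single j 1) i).det)
    {S : EuclideanSpace ℝ (Fin (n + 1)) → EuclideanSpace ℝ (Fin (n + 1))}
    {U : EuclideanSpace ℝ (Fin (n + 1)) → ℝ} (hU : ∀ x, HasGradientAt U (S x) x)
    (hS : ∀ x y, 0 ≤ ⟪x - y, S x - S y⟫) {r : ℝ} (hr : 0 ≤ r) (hSr : ∀ x, ‖S x‖ ≤ r) :
    ∫⁻ x, ((∏ j, ∑ α, f j α (L j α x)) * ENNReal.ofReal (fderiv ℝ S x).det) ^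
        (1 / ((n : ℝ) + 1)) ≤
      ENNReal.ofReal (32 * r) * ∏ j, (∑ α, ∫⁻ y, f j α y) ^ (1 / ((n : ℝ) + 1)) := by
  set v := fun j α => (A j α).symm (EuclideanSpace.single j 1)
  set q : (j : Fin (n + 1)) → Fin (m j) → EuclideanSpace ℝ (Fin (n + 1)) → ℝ≥0∞ :=
    fun j α x => ENNReal.ofReal ⟪fderiv ℝ S x (v j α), v j α⟫
  have hq : ∀ j α, Measurable (q j α) := fun j α =>
    ((measurable_fderiv_apply_const ℝ S (v j α)).inner measurable_const).ennreal_ofReal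
  have hfq : ∀ j α, Measurable fun x => f j α (L j α x) * q j α x := fun j α =>
    ((hf j α).comp (L j α).measurable).mul (hq j α)
  have hd : (0 : ℝ) < (n : ℝ) + 1 := by positivity
  have hp : (0 : ℝ) ≤ 1 / ((n : ℝ) + 1) := by positivity
  have hpt : ∀ x, (∏ j, ∑ α, f j α (L j α x)) * ENNReal.ofReal (fderiv ℝ S x).det ≤
      4 * ∏ j, ∑ α, f j α (L j α x) * q j α x := fun x => by
    obtain ⟨h1, h2⟩ := inner_fderiv_comm_and_nonneg hU hS x
    rw [Finset.prod_univ_sum, Finset.prod_univ_sum, Finset.sum_mul, Finset.mul_sum]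
    refine Finset.sum_le_sum fun κ _ => ?_
    rw [Finset.prod_mul_distrib, mul_left_comm]
    refine mul_le_mul' le_rfl ?_
    obtain ⟨h3, h4⟩ := ContinuousLinearMap.det_mul_sq_le_prod_inner (fderiv ℝ S x) h1 h2
      fun j => v j (κ j)
    rw [← ENNReal.ofReal_prod_of_nonneg fun j _ => h2 _,
      show (4 : ℝ≥0∞) = ENNReal.ofReal 4 by norm_num, ← ENNReal.ofReal_mul (by norm_num)]
    refine ENNReal.ofReal_le_ofReal ?_
    have h5 := htrans κ
    have h6 : (1 / 4 : ℝ) ≤ (Matrix.of fun i j => v j (κ j) i).det ^ 2 := by nlinarith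
    nlinarith [mul_le_mul_of_nonneg_left h6 h3]
  have hintegral : ∀ j, ∫⁻ x, ∑ α, f j α (L j α x) * q j α x ≤
      ENNReal.ofReal (8 * r) * ∑ α, ∫⁻ y, f j α y := fun j => by
    rw [lintegral_finsetSum _ fun α _ => hfq j α, Finset.mul_sum]
    refine Finset.sum_le_sum fun α _ => ?_
    have h0 := hdet j α
    refine (lintegral_comp_mul_le (hA j α) (by linarith) (hf j α) (hq j α)
      fun a => lintegral_inner_fderiv_line_le hS hSr a (v j α)).trans ?_
    refine mul_le_mul' ?_ le_rfl
    rw [← ENNReal.ofReal_mul (abs_nonneg _)]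
    refine ENNReal.ofReal_le_ofReal ?_
    have h1 : |(A j α : EuclideanSpace ℝ (Fin (n + 1)) →L[ℝ] _).det⁻¹| ≤ 2 := by
      rw [abs_of_nonneg (inv_nonneg.2 (by linarith))]
      exact inv_le_of_inv_le₀ (by norm_num) (by linarith)
    calc _ ≤ 2 * (2 * r * 2) := by
            refine mul_le_mul h1 ?_ (by positivity) (by norm_num)
            exact mul_le_mul_of_nonneg_left (hnorm j α) (by positivity)
      _ = 8 * r := by ring
  calc _ ≤ ∫⁻ x, 4 * ∏ j, (∑ α, f j α (L j α x) * q j α x) ^ (1 / ((n : ℝ) + 1)) := by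
        refine lintegral_mono fun x => (ENNReal.rpow_le_rpow (hpt x) hp).trans ?_
        rw [ENNReal.mul_rpow_of_nonneg _ _ hp, ENNReal.prod_rpow_of_nonneg hp]
        refine mul_le_mul' ?_ le_rfl
        conv_rhs => rw [← ENNReal.rpow_one 4]
        exact ENNReal.rpow_le_rpow_of_exponent_le (by norm_num)
          ((div_le_one hd).2 (by linarith [n.cast_nonneg (α := ℝ)]))
    _ = 4 * ∫⁻ x, ∏ j, (∑ α, f j α (L j α x) * q j α x) ^ (1 / ((n : ℝ) + 1)) :=
        lintegral_const_mul' _ _ (by norm_num)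
    _ ≤ 4 * ∏ j, (∫⁻ x, ∑ α, f j α (L j α x) * q j α x) ^ (1 / ((n : ℝ) + 1)) := by
        refine mul_le_mul' le_rfl (ENNReal.lintegral_prod_norm_pow_le _
          (fun j _ => (Finset.measurable_sum _ fun α _ => hfq j α).aemeasurable)
          ?_ fun j _ => hp)
        simp; field_simp
    _ ≤ 4 * ∏ j : Fin (n + 1), (ENNReal.ofReal (8 * r) * ∑ α, ∫⁻ y, f j α y) ^
          (1 / ((n : ℝ) + 1)) :=
        mul_le_mul' le_rfl (Finset.prod_le_prod' fun j _ => ENNReal.rpow_le_rpow (hintegral j) hp)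
    _ = _ := by
        simp_rw [ENNReal.mul_rpow_of_nonneg _ _ hp]
        rw [Finset.prod_mul_distrib, Finset.prod_const, Finset.card_univ, Fintype.card_fin,
          ← ENNReal.rpow_natCast, ← ENNReal.rpow_mul, ← mul_assoc]
        congr 1
        rw [show 1 / ((n : ℝ) + 1) * ((n + 1 : ℕ) : ℝ) = 1 by push_cast; field_simp,
          ENNReal.rpow_one, show (4 : ℝ≥0∞) = ENNReal.ofReal 4 by norm_num,
          ← ENNReal.ofReal_mul (by norm_num)]
        ring_nf

end Holder

section ChangeOfVariables

theorem injOn_and_image_eq {E : Type*} {S : E → E} {Y : Set E} {W : E → E} (hW : ∀ y ∈ Y, S (W y) = y) :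
    InjOn S {x | S x ∈ Y ∧ W (S x) = x} ∧ S '' {x | S x ∈ Y ∧ W (S x) = x} = Y := by
  refine ⟨fun x hx x' hx' h => by rw [← hx.2, ← hx'.2, h], Subset.antisymm ?_ fun y hy => ?_⟩
  · rintro _ ⟨x, hx, rfl⟩
    exact hx.1
  · exact ⟨W y, by simp [hW y hy, hy], hW y hy⟩

variable {E : Type*} [NormedAddCommGroup E] [InnerProductSpace ℝ E] [FiniteDimensional ℝ E]
  [MeasurableSpace E] [BorelSpace E] {μ : Measure E} [μ.IsAddHaarMeasure]

open Module in
theorem LipschitzOnWith.addHaar_image_le {K : ℝ≥0} {f : E → E} {s : Set E}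
    (hf : LipschitzOnWith K f s) : μ (f '' s) ≤ (K : ℝ≥0∞) ^ (finrank ℝ E : ℝ) * μ s := by
  rw [Measure.isAddLeftInvariant_eq_smul μ (μH[finrank ℝ E] : Measure E), Measure.smul_apply,
    Measure.smul_apply, ENNReal.smul_def, ENNReal.smul_def, smul_eq_mul, smul_eq_mul, mul_left_comm]
  exact mul_le_mul' le_rfl (hf.hausdorffMeasure_image_le (Nat.cast_nonneg _))

variable {S T : E → E} {τ : ℝ} {Y : Set E}

/-- If `S` inverts `T + τ id` and `T` transports Haar measure on `Y` to the density `g`, then the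
Jacobian of `S` along `T + τ id` is bounded by `g ∘ T`. -/
theorem ae_det_fderiv_le_density (hτ : 0 < τ) {K : ℝ≥0} (hSK : LipschitzWith K S)
    (hS : ∀ x x', τ * ‖S x - S x'‖ ^ 2 ≤ ⟪x - x', S x - S x'⟫) (hT : Measurable T)
    (hY : MeasurableSet Y) (hYfin : μ Y ≠ ⊤) (hST : ∀ y ∈ Y, S (T y + τ • y) = y)
    (g : SimpleFunc E ℝ≥0)
    (hmap : (μ.restrict Y).map T = μ.withDensity fun x => (g x : ℝ≥0∞)) :
    ∀ᵐ y ∂μ.restrict Y, DifferentiableAt ℝ S (T y + τ • y) ∧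
      ENNReal.ofReal |(fderiv ℝ S (T y + τ • y)).det| ≤ g (T y) := by
  have hSm : Measurable S := hSK.continuous.measurable
  have hW : Measurable fun y => T y + τ • y := hT.add (measurable_id.const_smul τ)
  have hDm : Measurable fun x => ENNReal.ofReal |(fderiv ℝ S x).det| :=
    (ContinuousLinearMap.continuous_det.measurable.comp (measurable_fderiv ℝ S)).abs.ennreal_ofReal
  have hdiff : ∀ᵐ y ∂μ.restrict Y, DifferentiableAt ℝ S (T y + τ • y) := by
    rw [ae_restrict_iff' hY]
    have h1 : μ {x | ¬ DifferentiableAt ℝ S x} = 0 := hSK.ae_differentiableAt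
    have h2 := (hSK.lipschitzOnWith (s := {x | ¬ DifferentiableAt ℝ S x})).addHaar_image_le (μ := μ)
    rw [h1, mul_zero, nonpos_iff_eq_zero] at h2
    filter_upwards [measure_eq_zero_iff_ae_notMem.1 h2] with y hy hyY
    by_contra h
    exact hy ⟨_, h, hST y hyY⟩
  have hN : LipschitzWith 1 fun x => x - τ • S x := by
    refine LipschitzWith.of_dist_le_mul fun x x' => ?_
    rw [NNReal.coe_one, one_mul, dist_eq_norm, dist_eq_norm]
    refine abs_le_of_sq_le_sq' ?_ (norm_nonneg _) |>.2
    have h1 : x - τ • S x - (x' - τ • S x') = (x - x') - τ • (S x - S x') := by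
      rw [smul_sub]; abel
    rw [h1, norm_sub_sq_real, real_inner_smul_right, norm_smul, mul_pow, Real.norm_eq_abs, sq_abs]
    have h2 := mul_le_mul_of_nonneg_left (hS x x') hτ.le
    have h3 : 0 ≤ τ ^ 2 * ‖S x - S x'‖ ^ 2 := by positivity
    nlinarith
  have hlevel : ∀ c : ℝ≥0, μ {y | y ∈ Y ∧ DifferentiableAt ℝ S (T y + τ • y) ∧ g (T y) = c ∧
      (c : ℝ≥0∞) < ENNReal.ofReal |(fderiv ℝ S (T y + τ • y)).det|} = 0 := fun c => by
    set B := {y | y ∈ Y ∧ DifferentiableAt ℝ S (T y + τ • y) ∧ g (T y) = c ∧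
      (c : ℝ≥0∞) < ENNReal.ofReal |(fderiv ℝ S (T y + τ • y)).det|}
    have hB : MeasurableSet B :=
      hY.inter (((measurableSet_of_differentiableAt ℝ S).preimage hW).inter
        (((g.measurableSet_fiber c).preimage hT).inter
          (measurableSet_lt measurable_const (hDm.comp hW))))
    obtain ⟨hinj, himg⟩ := injOn_and_image_eq (S := S) (Y := B) (W := fun y => T y + τ • y)
      fun y hy => hST y hy.1
    set A := {x | S x ∈ B ∧ T (S x) + τ • S x = x}
    have hA : MeasurableSet A :=
      (hB.preimage hSm).inter (measurableSet_eq_fun (hW.comp hSm) measurable_id)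
    have hAd : ∀ x ∈ A, DifferentiableAt ℝ S x ∧
        (c : ℝ≥0∞) < ENNReal.ofReal |(fderiv ℝ S x).det| := fun x hx => by
      have h1 := hx.1.2
      rw [hx.2] at h1
      exact ⟨h1.1, h1.2.2⟩
    have hBint : ∫⁻ x in A, ENNReal.ofReal |(fderiv ℝ S x).det| ∂μ = μ B := by
      rw [lintegral_abs_det_fderiv_eq_addHaar_image μ hA
        (fun x hx => (hAd x hx).1.hasFDerivAt.hasFDerivWithinAt) hinj, himg]
    have hTB : μ (T '' B) ≤ μ A := by
      have h1 : T '' B = (fun x => x - τ • S x) '' A := by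
        rw [← himg, image_image]
        refine image_congr fun x hx => ?_
        exact eq_sub_of_add_eq hx.2
      rw [h1]
      simpa using (hN.lipschitzOnWith (s := A)).addHaar_image_le (μ := μ)
    have hBA : μ B ≤ c * μ A := by
      set M := toMeasurable μ (T '' B) ∩ g ⁻¹' {c}
      have hM : MeasurableSet M := (measurableSet_toMeasurable _ _).inter (g.measurableSet_fiber c)
      calc μ B ≤ (μ.restrict Y).map T M := by
            rw [Measure.map_apply hT hM, Measure.restrict_apply (hT hM)]
            exact measure_mono fun y hy => ⟨⟨subset_toMeasurable _ _ ⟨y, hy, rfl⟩, hy.2.2.1⟩, hy.1⟩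
        _ = ∫⁻ x in M, (c : ℝ≥0∞) ∂μ := by
            rw [hmap, withDensity_apply _ hM]
            refine setLIntegral_congr_fun hM fun x hx => ?_
            rw [show g x = c from hx.2]
        _ = c * μ M := by rw [setLIntegral_const]
        _ ≤ c * μ A := by
            refine mul_le_mul' le_rfl ((measure_mono inter_subset_left).trans ?_)
            rwa [measure_toMeasurable]
    have hBfin : μ B ≠ ⊤ := measure_ne_top_of_subset (fun y hy => hy.1) hYfin
    have hle : (fun _ => (c : ℝ≥0∞)) ≤ᵐ[μ.restrict A]
        fun x => ENNReal.ofReal |(fderiv ℝ S x).det| := by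
      filter_upwards [ae_restrict_mem hA] with x hx using (hAd x hx).2.le
    have hcA : ∫⁻ _ in A, (c : ℝ≥0∞) ∂μ = c * μ A := setLIntegral_const _ _
    have heq := ae_eq_of_ae_le_of_lintegral_le hle
      (((lintegral_mono_ae hle).trans_lt (by rw [hBint]; exact hBfin.lt_top)).ne)
      hDm.aemeasurable (by rw [hBint, hcA]; exact hBA)
    have hA0 : μ A = 0 := by
      rw [← Measure.restrict_eq_zero, ← ae_eq_bot, ← Filter.eventually_false_iff_eq_bot]
      filter_upwards [heq, ae_restrict_mem hA] with x hx hxA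
      exact (hAd x hxA).2.ne hx
    rw [hA0, mul_zero] at hBA
    exact nonpos_iff_eq_zero.1 hBA
  have hall : ∀ᵐ y ∂μ.restrict Y, ∀ c ∈ g.range, y ∉ {y | y ∈ Y ∧
      DifferentiableAt ℝ S (T y + τ • y) ∧ g (T y) = c ∧
      (c : ℝ≥0∞) < ENNReal.ofReal |(fderiv ℝ S (T y + τ • y)).det|} := by
    rw [Filter.eventually_all_finset]
    exact fun c _ => ae_restrict_of_ae (measure_eq_zero_iff_ae_notMem.1 (hlevel c))
  filter_upwards [hdiff, hall, ae_restrict_mem hY] with y h1 h2 h3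
  exact ⟨h1, not_lt.1 fun h4 => h2 (g (T y)) (g.mem_range_self _) ⟨h3, h1, rfl, h4⟩⟩

theorem setLIntegral_comp_mul_rpow_le (hSm : Measurable S) (hT : Measurable T)
    (hY : MeasurableSet Y) (hST : ∀ y ∈ Y, S (T y + τ • y) = y)
    (g : E → ℝ≥0∞) (hg : Measurable g)
    (hdens : ∀ᵐ y ∂μ.restrict Y, DifferentiableAt ℝ S (T y + τ • y) ∧
      ENNReal.ofReal |(fderiv ℝ S (T y + τ • y)).det| ≤ g (T y))
    {H : E → ℝ≥0∞} {p : ℝ} (hp1 : p ≤ 1) :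
    ∫⁻ y in Y, H (T y + τ • y) * g (T y) ^ (p - 1) ∂μ ≤
      ∫⁻ x, H x * ENNReal.ofReal |(fderiv ℝ S x).det| ^ p ∂μ := by
  have hW : Measurable fun y => T y + τ • y := hT.add (measurable_id.const_smul τ)
  have hDm : Measurable fun x => ENNReal.ofReal |(fderiv ℝ S x).det| :=
    (ContinuousLinearMap.continuous_det.measurable.comp (measurable_fderiv ℝ S)).abs.ennreal_ofReal
  set B := {y | y ∈ Y ∧ DifferentiableAt ℝ S (T y + τ • y) ∧
    ENNReal.ofReal |(fderiv ℝ S (T y + τ • y)).det| ≤ g (T y)}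
  have hB : MeasurableSet B :=
    hY.inter (((measurableSet_of_differentiableAt ℝ S).preimage hW).inter
      (measurableSet_le (hDm.comp hW) (hg.comp hT)))
  have hYB : (Y : Set E) =ᵐ[μ] B := by
    rw [ae_restrict_iff' hY] at hdens
    filter_upwards [hdens] with y hy
    exact propext ⟨fun h => ⟨h, hy h⟩, fun h => h.1⟩
  obtain ⟨hinj, himg⟩ := injOn_and_image_eq (S := S) (Y := B) (W := fun y => T y + τ • y)
    fun y hy => hST y hy.1
  set A := {x | S x ∈ B ∧ T (S x) + τ • S x = x}
  have hA : MeasurableSet A :=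
    (hB.preimage hSm).inter (measurableSet_eq_fun (hW.comp hSm) measurable_id)
  have hAd : ∀ x ∈ A, DifferentiableAt ℝ S x ∧
      ENNReal.ofReal |(fderiv ℝ S x).det| ≤ g (T (S x)) := fun x hx => by
    have h1 := hx.1.2
    rwa [hx.2] at h1
  rw [setLIntegral_congr hYB, ← himg, lintegral_image_eq_lintegral_abs_det_fderiv_mul μ hA
    (fun x hx => (hAd x hx).1.hasFDerivAt.hasFDerivWithinAt) hinj]
  refine (setLIntegral_mono' hA fun x hx => ?_).trans (setLIntegral_le_lintegral A _)
  rw [hx.2, mul_left_comm]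
  refine mul_le_mul' le_rfl ?_
  set D := ENNReal.ofReal |(fderiv ℝ S x).det|
  rcases eq_or_ne D 0 with h0 | h0
  · simp [h0]
  calc D * g (T (S x)) ^ (p - 1) ≤ D * D ^ (p - 1) := by
        rw [← neg_sub, ENNReal.rpow_neg, ENNReal.rpow_neg]
        exact mul_le_mul' le_rfl
          (ENNReal.inv_le_inv.2 (ENNReal.rpow_le_rpow (hAd x hx).2 (sub_nonneg.2 hp1)))
    _ = D ^ p := by
        conv_lhs => enter [1]; rw [← ENNReal.rpow_one D]
        rw [← ENNReal.rpow_add _ _ h0 ENNReal.ofReal_ne_top]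
        congr 1
        ring

end ChangeOfVariables

section Transport

variable {E : Type*} [NormedAddCommGroup E] [InnerProductSpace ℝ E] [FiniteDimensional ℝ E]
  [MeasurableSpace E] [BorelSpace E] {μ : Measure E} [μ.IsAddHaarMeasure]

theorem LowerSemicontinuous.le_liminf_comp {X : Type*} [TopologicalSpace X] {φ : X → ℝ≥0∞}
    (hφ : LowerSemicontinuous φ) {x : X} {u : ℕ → X} (hu : Tendsto u atTop (𝓝 x)) :
    φ x ≤ liminf (fun k => φ (u k)) atTop :=
  le_of_forall_lt fun b hb => by
    obtain ⟨c, hbc, hc⟩ := exists_between hb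
    refine hbc.trans_le (le_liminf_of_le (by isBoundedDefault) ?_)
    filter_upwards [hu.eventually (hφ x c hc)] with k hk using hk.le

/-- An integral bound by transport: test `H` against the Jacobians of monotone gradient maps into the
ball whose measure is the mass of `g`. -/
theorem lintegral_le_of_forall_gradient {H : E → ℝ≥0∞} (hH : LowerSemicontinuous H)
    {g : SimpleFunc E ℝ≥0} {p : ℝ} (hp1 : p ≤ 1)
    (hgH : ∀ x, (g x : ℝ≥0∞) ^ (1 - p) ≤ H x) {K : Set E} (hK : IsCompact K) (hKne : K.Nonempty)
    (hgK : ∀ x ∉ K, g x = 0) {r : ℝ} (hr : 0 ≤ r)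
    (hgr : ∫⁻ x, g x ∂μ = μ (Metric.closedBall 0 r)) {B : ℝ≥0∞}
    (hB : ∀ (S : E → E) (U : E → ℝ), (∀ x, HasGradientAt U (S x) x) →
      (∀ x y, 0 ≤ ⟪x - y, S x - S y⟫) → (∀ x, ‖S x‖ ≤ r) →
      ∫⁻ x, H x * ENNReal.ofReal |(fderiv ℝ S x).det| ^ p ∂μ ≤ B) :
    ∫⁻ x, g x ∂μ ≤ B := by
  set Y₀ := Metric.closedBall (0 : E) r
  have hY₀ : IsCompact Y₀ := isCompact_closedBall 0 r
  have hY₀ne : Y₀.Nonempty := Metric.nonempty_closedBall.2 hr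
  obtain ⟨w, hw, ⟨C, hwC⟩, hmap⟩ := exists_map_gradient_eq hK hKne hY₀ hY₀ne μ
    (μ.withDensity fun x => (g x : ℝ≥0∞)) (by rw [withDensity_apply _ .univ, setLIntegral_univ, hgr])
    (by
      rw [withDensity_apply _ hK.measurableSet.compl, setLIntegral_eq_zero_iff
        hK.measurableSet.compl g.measurable.coe_nnreal_ennreal]
      exact ae_of_all _ fun x hx => by simp [hgK x hx])
  set T := gradient w
  have hT : Measurable T := measurable_gradient w
  set Y := Y₀ ∩ {y | DifferentiableAt ℝ w y}
  have hY : MeasurableSet Y :=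
    hY₀.measurableSet.inter (measurableSet_of_differentiableAt ℝ w)
  have hYY₀ : Y =ᵐ[μ] Y₀ := by
    filter_upwards [hwC.ae_differentiableAt (μ := μ)] with y hy
    exact propext ⟨fun h => h.1, fun h => ⟨h, hy⟩⟩
  rw [← Measure.restrict_congr_set hYY₀] at hmap
  have hYfin : μ Y ≠ ⊤ := measure_ne_top_of_subset inter_subset_left hY₀.measure_ne_top
  have hstep : ∀ τ : ℝ, 0 < τ →
      ∫⁻ y in Y, H (T y + τ • y) * (g (T y) : ℝ≥0∞) ^ (p - 1) ∂μ ≤ B := fun τ hτ => by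
    obtain ⟨S, U, hSY, hS, hU, hST⟩ := hw.exists_regularized_gradient hwC.continuous hY₀
      (convex_closedBall 0 r) hY₀ne hτ
    have hSK : LipschitzWith (Real.toNNReal τ⁻¹) S := LipschitzWith.of_dist_le_mul fun x x' => by
      rw [Real.coe_toNNReal _ (by positivity), dist_eq_norm, dist_eq_norm,
        ← div_eq_inv_mul, le_div_iff₀' hτ]
      rcases (norm_nonneg (S x - S x')).eq_or_lt with h0 | h0
      · rw [← h0, mul_zero]; exact norm_nonneg _
      · refine le_of_mul_le_mul_right ?_ h0
        calc _ = τ * ‖S x - S x'‖ ^ 2 := by ring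
          _ ≤ _ := (hS x x').trans (real_inner_le_norm _ _)
    have hSYr : ∀ y ∈ Y, S (T y + τ • y) = y := fun y hy => hST y hy.1 hy.2
    exact (setLIntegral_comp_mul_rpow_le hSK.continuous.measurable hT hY hSYr _
      g.measurable.coe_nnreal_ennreal (ae_det_fderiv_le_density hτ hSK hS hT hY hYfin hSYr g hmap)
      hp1).trans (hB S U hU (fun x y => (by positivity : (0 : ℝ) ≤ τ * ‖S x - S y‖ ^ 2).trans
        (hS x y)) fun x => mem_closedBall_zero_iff.1 (hSY x))
  have hpos : ∀ᵐ y ∂μ.restrict Y, g (T y) ≠ 0 := by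
    have h0 : MeasurableSet (g ⁻¹' {0}) := g.measurableSet_fiber 0
    have h1 : (μ.restrict Y).map T (g ⁻¹' {0}) = 0 := by
      rw [hmap, withDensity_apply _ h0, setLIntegral_eq_zero_iff h0
        g.measurable.coe_nnreal_ennreal]
      exact ae_of_all _ fun x hx => by simpa using hx
    rw [Measure.map_apply hT h0] at h1
    filter_upwards [measure_eq_zero_iff_ae_notMem.1 h1] with y hy using hy
  set τ : ℕ → ℝ := fun k => 1 / ((k : ℝ) + 1)
  have hτ : Tendsto τ atTop (𝓝 0) := tendsto_one_div_add_atTop_nhds_zero_nat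
  calc ∫⁻ x, g x ∂μ = ∫⁻ _ in Y, 1 ∂μ := by rw [setLIntegral_one, hgr, measure_congr hYY₀]
    _ ≤ ∫⁻ y in Y, liminf (fun k => H (T y + τ k • y) * (g (T y) : ℝ≥0∞) ^ (p - 1)) atTop ∂μ := by
        refine lintegral_mono_ae ?_
        filter_upwards [hpos] with y hy
        have hy' : (g (T y) : ℝ≥0∞) ≠ 0 := by simpa using hy
        have hc : (g (T y) : ℝ≥0∞) ^ (p - 1) ≠ ⊤ := by
          simp [ENNReal.rpow_eq_top_iff, hy]
        have hlsc : LowerSemicontinuous fun x => H x * (g (T y) : ℝ≥0∞) ^ (p - 1) :=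
          (ENNReal.continuous_mul_const hc).comp_lowerSemicontinuous hH
            fun a b hab => mul_le_mul' hab le_rfl
        have hlim : Tendsto (fun k => T y + τ k • y) atTop (𝓝 (T y)) := by
          simpa using (hτ.smul_const y).const_add (T y)
        refine le_trans ?_ (hlsc.le_liminf_comp hlim)
        calc (1 : ℝ≥0∞) = (g (T y) : ℝ≥0∞) ^ (1 - p) * (g (T y) : ℝ≥0∞) ^ (p - 1) := by
              rw [← ENNReal.rpow_add _ _ hy' ENNReal.coe_ne_top]; simp
          _ ≤ _ := mul_le_mul' (hgH _) le_rfl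
    _ ≤ liminf (fun k => ∫⁻ y in Y, H (T y + τ k • y) * (g (T y) : ℝ≥0∞) ^ (p - 1) ∂μ) atTop :=
        lintegral_liminf_le fun k => (hH.measurable.comp
          (hT.add (measurable_id.const_smul (τ k)))).mul
            ((g.measurable.coe_nnreal_ennreal.comp hT).pow_const _)
    _ ≤ B := liminf_le_of_le (by isBoundedDefault) fun b hb => by
        obtain ⟨k, hk⟩ := hb.exists
        exact hk.trans (hstep _ (by positivity))

end Transport

section Scaling

variable {E : Type*} [NormedAddCommGroup E] [InnerProductSpace ℝ E] [FiniteDimensional ℝ E]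
  [MeasurableSpace E] [BorelSpace E] {μ : Measure E} [μ.IsAddHaarMeasure]

theorem ENNReal.rpow_natCast_div_pow (Q : ℝ≥0∞) (n : ℕ) :
    (Q ^ ((n : ℝ) / (n + 1))) ^ (n + 1) = Q ^ n := by
  rw [← ENNReal.rpow_natCast, ← ENNReal.rpow_mul, ← ENNReal.rpow_natCast Q n]
  congr 1
  push_cast
  field_simp

theorem ENNReal.le_of_le_mul_rpow {n : ℕ} (hn : n ≠ 0) {I M R Q ω : ℝ≥0∞} (hI0 : I ≠ 0)
    (hI : I ≠ ⊤) (hω0 : ω ≠ 0) (hω : ω ≠ ⊤) (hR : R ^ (n + 1) * ω = I)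
    (h : I ≤ M * R * Q ^ ((n : ℝ) / (n + 1))) :
    I ≤ (M ^ (n + 1) / ω) ^ (1 / (n : ℝ)) * Q := by
  have h1 : I ^ n * I ≤ M ^ (n + 1) / ω * Q ^ n * I := by
    calc I ^ n * I = I ^ (n + 1) := (pow_succ I n).symm
      _ ≤ (M * R * Q ^ ((n : ℝ) / (n + 1))) ^ (n + 1) := by gcongr
      _ = M ^ (n + 1) * R ^ (n + 1) * Q ^ n := by
          rw [mul_pow, mul_pow, ENNReal.rpow_natCast_div_pow]
      _ = M ^ (n + 1) * (R ^ (n + 1) * ω * ω⁻¹) * Q ^ n := by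
          rw [mul_assoc (R ^ (n + 1)), ENNReal.mul_inv_cancel hω0 hω, mul_one]
      _ = M ^ (n + 1) / ω * Q ^ n * I := by rw [hR, div_eq_mul_inv]; ring
  have h2 := (ENNReal.mul_le_mul_iff_left hI0 hI).1 h1
  have hn' : (n : ℝ) ≠ 0 := Nat.cast_ne_zero.2 hn
  have h3 : ∀ x : ℝ≥0∞, (x ^ n) ^ (1 / (n : ℝ)) = x := fun x => by
    rw [← ENNReal.rpow_natCast, ← ENNReal.rpow_mul, mul_one_div_cancel hn', ENNReal.rpow_one]
  calc I = (I ^ n) ^ (1 / (n : ℝ)) := (h3 I).symm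
    _ ≤ (M ^ (n + 1) / ω * Q ^ n) ^ (1 / (n : ℝ)) := ENNReal.rpow_le_rpow h2 (by positivity)
    _ = _ := by rw [ENNReal.mul_rpow_of_nonneg _ _ (by positivity), h3]

open Module in
theorem lintegral_le_mul_of_forall_gradient {n : ℕ} (hn : n ≠ 0) (hE : finrank ℝ E = n + 1)
    {G : E → ℝ≥0∞} (hG : LowerSemicontinuous G) {M Q : ℝ≥0∞}
    (hB : ∀ (r : ℝ) (S : E → E) (U : E → ℝ), 0 ≤ r → (∀ x, HasGradientAt U (S x) x) →
      (∀ x y, 0 ≤ ⟪x - y, S x - S y⟫) → (∀ x, ‖S x‖ ≤ r) →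
      ∫⁻ x, G x ^ ((n : ℝ) / (n + 1)) *
        ENNReal.ofReal |(fderiv ℝ S x).det| ^ (1 / ((n : ℝ) + 1)) ∂μ ≤
          M * ENNReal.ofReal r * Q ^ ((n : ℝ) / (n + 1))) :
    ∫⁻ x, G x ∂μ ≤ (M ^ (n + 1) / μ (Metric.ball 0 1)) ^ (1 / (n : ℝ)) * Q := by
  set ω := μ (Metric.ball (0 : E) 1)
  have hω0 : ω ≠ 0 := (Metric.measure_ball_pos μ 0 one_pos).ne'
  have hω : ω ≠ ⊤ := measure_ball_lt_top.ne
  have hp : (0 : ℝ) ≤ (n : ℝ) / (n + 1) := by positivity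
  have hp1 : 1 - 1 / ((n : ℝ) + 1) = (n : ℝ) / (n + 1) := by field_simp; ring
  have hcover := aecover_closedBall (μ := μ) (x := (0 : E))
    (tendsto_natCast_atTop_atTop (R := ℝ))
  refine le_of_tendsto' (hcover.lintegral_tendsto_of_nat hG.measurable.aemeasurable) fun k => ?_
  rw [← lintegral_indicator (hcover.measurableSet k), lintegral_eq_nnreal]
  refine iSup₂_le fun g hg => ?_
  rw [← SimpleFunc.lintegral_eq_lintegral]
  simp only [SimpleFunc.coe_map, Function.comp_apply]
  set K := Metric.closedBall (0 : E) k
  have hgG : ∀ x, (g x : ℝ≥0∞) ≤ G x := fun x =>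
    (hg x).trans (indicator_le_self' (fun _ _ => zero_le) x)
  have hgK : ∀ x ∉ K, g x = 0 := fun x hx => by simpa [hx] using hg x
  set I := ∫⁻ x, (g x : ℝ≥0∞) ∂μ
  rcases eq_or_ne I 0 with hI0 | hI0
  · rw [hI0]; exact zero_le
  have hI : I ≠ ⊤ := by
    obtain ⟨C, hC⟩ := g.exists_forall_le
    refine ne_top_of_le_ne_top (b := C * μ K)
      (ENNReal.mul_ne_top ENNReal.coe_ne_top (isCompact_closedBall 0 _).measure_ne_top) ?_
    rw [← setLIntegral_const, ← lintegral_indicator (hcover.measurableSet k)]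
    refine lintegral_mono fun x => ?_
    by_cases hx : x ∈ K
    · rw [indicator_of_mem hx]
      exact ENNReal.coe_le_coe.2 (hC x)
    · simp [hgK x hx]
  set r : ℝ := ((I / ω) ^ (1 / ((n : ℝ) + 1))).toReal
  have hIω : I / ω ≠ ⊤ := ENNReal.div_ne_top hI hω0
  have hr : ENNReal.ofReal r ^ (n + 1) * ω = I := by
    rw [ENNReal.ofReal_toReal (ENNReal.rpow_ne_top_of_nonneg (by positivity) hIω),
      ← ENNReal.rpow_natCast, ← ENNReal.rpow_mul]
    push_cast
    rw [one_div_mul_cancel (by positivity), ENNReal.rpow_one, ENNReal.div_mul_cancel hω0 hω]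
  have hr0 : 0 ≤ r := ENNReal.toReal_nonneg
  refine ENNReal.le_of_le_mul_rpow hn hI0 hI hω0 hω hr ?_
  refine lintegral_le_of_forall_gradient (K := K) (p := 1 / ((n : ℝ) + 1)) (r := r)
    ((ENNReal.continuous_rpow_const (y := (n : ℝ) / (n + 1))).comp_lowerSemicontinuous hG
      (ENNReal.monotone_rpow_of_nonneg hp))
    ((div_le_one (by positivity)).2 (by linarith [n.cast_nonneg (α := ℝ)]))
    (fun x => by rw [hp1]; exact ENNReal.rpow_le_rpow (hgG x) hp)
    (isCompact_closedBall 0 _) (Metric.nonempty_closedBall.2 (by positivity)) hgK hr0 ?_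
    fun S U hU hS hSr => hB r S U hr0 hU hS hSr
  rw [Measure.addHaar_closedBall μ 0 hr0, hE, ENNReal.ofReal_pow hr0]
  exact hr.symm

end Scaling

section LoomisWhitney

theorem LowerSemicontinuous.ennreal_mul {X : Type*} [TopologicalSpace X] {φ ψ : X → ℝ≥0∞}
    (hφ : LowerSemicontinuous φ) (hψ : LowerSemicontinuous ψ) :
    LowerSemicontinuous fun x => φ x * ψ x :=
  lowerSemicontinuous_iff_le_liminf.2 fun x =>
    (mul_le_mul' (hφ.le_liminf x) (hψ.le_liminf x)).trans ENNReal.le_liminf_mul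

theorem LowerSemicontinuous.ennreal_prod {X ι : Type*} [TopologicalSpace X] {φ : ι → X → ℝ≥0∞}
    {s : Finset ι} (hφ : ∀ i ∈ s, LowerSemicontinuous (φ i)) :
    LowerSemicontinuous fun x => ∏ i ∈ s, φ i x := by
  classical
  induction s using Finset.induction_on with
  | empty => simpa using lowerSemicontinuous_const
  | insert a s ha ih =>
    simp_rw [Finset.prod_insert ha]
    exact (hφ a (Finset.mem_insert_self a s)).ennreal_mul
      (ih fun i hi => hφ i (Finset.mem_insert_of_mem hi))

variable {n : ℕ} {m : Fin (n + 1) → ℕ}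
    {f : (j : Fin (n + 1)) → Fin (m j) → EuclideanSpace ℝ (Fin n) → ℝ≥0∞}
    {L : (j : Fin (n + 1)) → Fin (m j) →
      (EuclideanSpace ℝ (Fin (n + 1)) →L[ℝ] EuclideanSpace ℝ (Fin n))}
    {A : (j : Fin (n + 1)) → Fin (m j) →
      (EuclideanSpace ℝ (Fin (n + 1)) ≃L[ℝ] EuclideanSpace ℝ (Fin (n + 1)))}

theorem lintegral_prod_rpow_le_of_lowerSemicontinuous (hn : n ≠ 0)
    (hf : ∀ j α, LowerSemicontinuous (f j α))
    (hA : ∀ j α z i, L j α ((A j α).symm z) i = z (j.succAbove i))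
    (hdet : ∀ j α, 1 / 2 ≤
      (A j α : EuclideanSpace ℝ (Fin (n + 1)) →L[ℝ] EuclideanSpace ℝ (Fin (n + 1))).det)
    (hnorm : ∀ j α, ‖(A j α).symm (EuclideanSpace.single j 1)‖ ≤ 2)
    (htrans : ∀ κ : (j : Fin (n + 1)) → Fin (m j), 1 / 2 ≤
      (Matrix.of fun i j => (A j (κ j)).symm (EuclideanSpace.single j 1) i).det) :
    ∫⁻ x, ∏ j, (∑ α, f j α (L j α x)) ^ (1 / (n : ℝ)) ≤
      (32 ^ (n + 1) / volume (Metric.ball (0 : EuclideanSpace ℝ (Fin (n + 1))) 1)) ^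
        (1 / (n : ℝ)) * ∏ j, (∑ α, ∫⁻ y, f j α y) ^ (1 / (n : ℝ)) := by
  have hp : (0 : ℝ) ≤ 1 / (n : ℝ) := by positivity
  have hp' : (0 : ℝ) ≤ (n : ℝ) / (n + 1) := by positivity
  have hp'' : (0 : ℝ) ≤ 1 / ((n : ℝ) + 1) := by positivity
  have hn' : (n : ℝ) ≠ 0 := Nat.cast_ne_zero.2 hn
  have hprod : ∀ F : Fin (n + 1) → ℝ≥0∞, (∏ j, F j ^ (1 / (n : ℝ))) ^ ((n : ℝ) / (n + 1)) =
      ∏ j, F j ^ (1 / ((n : ℝ) + 1)) := fun F => by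
    rw [← ENNReal.prod_rpow_of_nonneg hp']
    refine Finset.prod_congr rfl fun j _ => ?_
    rw [← ENNReal.rpow_mul]
    congr 1
    field_simp
  refine lintegral_le_mul_of_forall_gradient hn (by simp) ?_ fun r S U hr hU hS hSr => ?_
  · refine LowerSemicontinuous.ennreal_prod fun j _ =>
      ENNReal.continuous_rpow_const.comp_lowerSemicontinuous ?_ (ENNReal.monotone_rpow_of_nonneg hp)
    exact lowerSemicontinuous_sum fun α _ => (hf j α).comp (L j α).continuous
  · rw [hprod]
    have h32 : (32 : ℝ≥0∞) * ENNReal.ofReal r = ENNReal.ofReal (32 * r) := by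
      rw [ENNReal.ofReal_mul (by norm_num)]; norm_num
    rw [h32]
    refine le_trans (le_of_eq (lintegral_congr fun x => ?_)) (lintegral_prod_mul_det_le
      (fun j α => (hf j α).measurable) hA hdet hnorm htrans hU hS hr hSr)
    obtain ⟨h1, h2⟩ := inner_fderiv_comm_and_nonneg hU hS x
    rw [hprod, ENNReal.prod_rpow_of_nonneg hp'', ← ENNReal.mul_rpow_of_nonneg _ _ hp'',
      abs_of_nonneg (ContinuousLinearMap.det_mul_sq_le_prod_inner _ h1 h2
        fun j => EuclideanSpace.single j 1).1]

theorem lintegral_prod_rpow_le (hn : n ≠ 0) (hf : ∀ j α, Measurable (f j α))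
    (hA : ∀ j α z i, L j α ((A j α).symm z) i = z (j.succAbove i))
    (hdet : ∀ j α, 1 / 2 ≤
      (A j α : EuclideanSpace ℝ (Fin (n + 1)) →L[ℝ] EuclideanSpace ℝ (Fin (n + 1))).det)
    (hnorm : ∀ j α, ‖(A j α).symm (EuclideanSpace.single j 1)‖ ≤ 2)
    (htrans : ∀ κ : (j : Fin (n + 1)) → Fin (m j), 1 / 2 ≤
      (Matrix.of fun i j => (A j (κ j)).symm (EuclideanSpace.single j 1) i).det) :
    ∫⁻ x, ∏ j, (∑ α, f j α (L j α x)) ^ (1 / (n : ℝ)) ≤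
      (32 ^ (n + 1) / volume (Metric.ball (0 : EuclideanSpace ℝ (Fin (n + 1))) 1)) ^
        (1 / (n : ℝ)) * (2 ^ (1 / (n : ℝ))) ^ (n + 1) *
          ∏ j, (∑ α, ∫⁻ y, f j α y) ^ (1 / (n : ℝ)) := by
  have hp : (0 : ℝ) < 1 / (n : ℝ) := by have := Nat.pos_of_ne_zero hn; positivity
  by_cases hP : ∃ j, ∑ α, ∫⁻ y, f j α y = 0
  · obtain ⟨j, hj⟩ := hP
    have h0 : ∀ α, ∀ᵐ x, f j α (L j α x) = 0 := fun α => by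
      have h1 := lintegral_comp_mul_le (hA j α) (by linarith [hdet j α]) (hf j α)
        (q := fun _ => 1) measurable_const (c := ⊤) fun _ => le_top
      rw [Finset.sum_eq_zero_iff.1 hj α (Finset.mem_univ α), mul_zero, nonpos_iff_eq_zero] at h1
      simp only [mul_one] at h1
      exact (lintegral_eq_zero_iff ((hf j α).comp (L j α).measurable)).1 h1
    refine le_trans (le_of_eq ?_) zero_le
    refine lintegral_eq_zero_of_ae_eq_zero ?_
    filter_upwards [ae_all_iff.2 h0] with x hx
    refine Finset.prod_eq_zero (Finset.mem_univ j) ?_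
    simp [hx, Nat.pos_of_ne_zero hn]
  · push Not at hP
    set ε : Fin (n + 1) → ℝ≥0∞ := fun j => (∑ α, ∫⁻ y, f j α y) / m j
    have hε : ∀ j, ε j ≠ 0 := fun j => ENNReal.div_ne_zero.2 ⟨hP j, ENNReal.natCast_ne_top _⟩
    choose f' hff' hf' hintegral using fun j α =>
      exists_le_lowerSemicontinuous_lintegral_ge volume (f j α) (hf j α) (hε j)
    have hsum : ∀ j, ∑ α, ∫⁻ y, f' j α y ≤ 2 * ∑ α, ∫⁻ y, f j α y := fun j => by
      refine (Finset.sum_le_sum fun α _ => hintegral j α).trans ?_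
      rw [Finset.sum_add_distrib, two_mul, Finset.sum_const, Finset.card_univ, Fintype.card_fin,
        nsmul_eq_mul]
      exact add_le_add le_rfl ENNReal.mul_div_le
    calc _ ≤ ∫⁻ x, ∏ j, (∑ α, f' j α (L j α x)) ^ (1 / (n : ℝ)) :=
          lintegral_mono fun x => Finset.prod_le_prod' fun j _ => ENNReal.rpow_le_rpow
            (Finset.sum_le_sum fun α _ => hff' j α _) hp.le
      _ ≤ _ := lintegral_prod_rpow_le_of_lowerSemicontinuous hn hf' hA hdet hnorm htrans
      _ ≤ (32 ^ (n + 1) / volume (Metric.ball (0 : EuclideanSpace ℝ (Fin (n + 1))) 1)) ^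
        (1 / (n : ℝ)) * ∏ j, (2 * ∑ α, ∫⁻ y, f j α y) ^ (1 / (n : ℝ)) :=
          mul_le_mul' le_rfl (Finset.prod_le_prod' fun j _ => ENNReal.rpow_le_rpow (hsum j) hp.le)
      _ = _ := by
          simp_rw [ENNReal.mul_rpow_of_nonneg _ _ hp.le]
          rw [Finset.prod_mul_distrib, Finset.prod_const, Finset.card_univ, Fintype.card_fin,
            mul_assoc]

end LoomisWhitney

/-- The "combinatorial" (vector-valued) Loomis–Whitney inequality, an equivalent
functional form of Guth's endpoint `d`-linear Kakeya theorem (`d = n+1 ≥ 2`):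
there exist `ε > 0` and `C`, depending only on the dimension, such that for finite
families of nonnegative functions `f_{j,α}` on `ℝ^{d-1}` and linear maps
`L_{j,α} : ℝ^d → ℝ^{d-1}` with `‖L_{j,α} − π_j‖ ≤ ε`,
`∫ ∏_j (∑_α f_{j,α} ∘ L_{j,α})^{1/(d-1)} ≤ C ∏_j (∑_α ∫ f_{j,α})^{1/(d-1)}`. -/
theorem combinatorial_loomis_whitney (n : ℕ) (hn : 1 ≤ n) :
    ∃ ε > 0, ∃ C > 0,
      ∀ (m : Fin (n + 1) → ℕ)
        (f : (j : Fin (n + 1)) → Fin (m j) → EuclideanSpace ℝ (Fin n) → ℝ≥0∞)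
        (L : (j : Fin (n + 1)) → Fin (m j) →
          (EuclideanSpace ℝ (Fin (n + 1)) →L[ℝ] EuclideanSpace ℝ (Fin n))),
        (∀ j α, Measurable (f j α)) →
        (∀ j α, ‖L j α - coordProj n j‖ ≤ ε) →
        ∫⁻ x, ∏ j, (∑ α, f j α (L j α x)) ^ (1 / (n : ℝ))
          ≤ ENNReal.ofReal C * ∏ j, (∑ α, ∫⁻ y, f j α y) ^ (1 / (n : ℝ)) := by
  obtain ⟨η, hη, htrans⟩ := exists_half_le_det (n + 1)
  choose ε hε hL using fun j : Fin (n + 1) => exists_straightening j (lt_min hη one_pos)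
  set c : ℝ≥0∞ := (32 ^ (n + 1) / volume (Metric.ball (0 : EuclideanSpace ℝ (Fin (n + 1))) 1)) ^
    (1 / (n : ℝ)) * (2 ^ (1 / (n : ℝ))) ^ (n + 1)
  have hc : c ≠ ⊤ := by
    refine ENNReal.mul_ne_top (ENNReal.rpow_ne_top_of_nonneg (by positivity)
      (ENNReal.div_ne_top (by norm_num) (Metric.measure_ball_pos volume 0 one_pos).ne'))
      (ENNReal.pow_ne_top (ENNReal.rpow_ne_top_of_nonneg (by positivity) (by norm_num)))
  refine ⟨Finset.univ.inf' Finset.univ_nonempty ε, (Finset.lt_inf'_iff _).2 fun j _ => hε j,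
    c.toReal + 1, by positivity, fun m f L hf hLε => ?_⟩
  choose A hdet hA hv using fun j α =>
    hL j (L j α) ((hLε j α).trans (Finset.inf'_le _ (Finset.mem_univ j)))
  refine (lintegral_prod_rpow_le (by lia) hf hA hdet (fun j α => ?_) fun κ =>
    htrans _ fun j => (hv j (κ j)).trans (min_le_left _ _)).trans (mul_le_mul' ?_ le_rfl)
  · have h1 := norm_le_norm_add_norm_sub' ((A j α).symm (EuclideanSpace.single j 1))
      (EuclideanSpace.single j (1 : ℝ))
    have h2 := (hv j α).trans (min_le_right _ _)
    have h3 : ‖(EuclideanSpace.single j (1 : ℝ) : EuclideanSpace ℝ (Fin (n + 1)))‖ = 1 := by simp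
    linarith
  · exact (ENNReal.le_ofReal_iff_toReal_le hc (by positivity)).2 (by linarith)
end

section
/- Let L_j : ℝ^d → ℝ^{d_j} be surjective linear maps and p_j ∈ [0,∞) for j = 1, …, k, and define the Brascamp–Lieb constant BL(L,p) as the supremum of ∫_{ℝ^d} ∏_{j=1}^k (f_j ∘ L_j)^{p_j} over all nonnegative measurable f_j : ℝ^{d_j} → [0,∞] with ∫_{ℝ^{d_j}} f_j = 1. Then BL(L,p) < ∞ if and only if both (i) ∑_{j=1}^k p_j d_j = d, and (ii) dim V ≤ ∑_{j=1}^k p_j dim(L_j V) for every linear subspace V ⊆ ℝ^d. -/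
open MeasureTheory
open scoped ENNReal

/-- The Brascamp–Lieb constant `BL(L,p)`: the supremum of
`∫_{ℝ^d} ∏_j (f_j ∘ L_j)^{p_j}` over all nonnegative measurable `f_j` with
`∫ f_j = 1`. -/
noncomputable def BLconst {k d : ℕ} {dj : Fin k → ℕ}
    (L : (j : Fin k) → EuclideanSpace ℝ (Fin d) →ₗ[ℝ] EuclideanSpace ℝ (Fin (dj j)))
    (p : Fin k → ℝ) : ℝ≥0∞ :=
  ⨆ (f : (j : Fin k) → EuclideanSpace ℝ (Fin (dj j)) → ℝ≥0∞)
    (_ : ∀ j, Measurable (f j)) (_ : ∀ j, ∫⁻ y, f j y = 1),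
    ∫⁻ x, ∏ j, f j (L j x) ^ p j

section Haar

variable {E : Type*} [NormedAddCommGroup E] [NormedSpace ℝ E] [FiniteDimensional ℝ E]
  [MeasurableSpace E] [BorelSpace E]

/-- Two Haar measures agree up to a finite nonzero constant. -/
lemma exists_eq_smul_of_isAddHaarMeasure (μ μ' : Measure E) [μ.IsAddHaarMeasure]
    [μ'.IsAddHaarMeasure] : ∃ c : ℝ≥0∞, c ≠ 0 ∧ c ≠ ⊤ ∧ μ' = c • μ := by
  refine ⟨(μ'.addHaarScalarFactor μ : ℝ≥0∞), ?_, ENNReal.coe_ne_top, ?_⟩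
  · exact_mod_cast (Measure.addHaarScalarFactor_pos_of_isAddHaarMeasure μ' μ).ne'
  · exact Measure.isAddLeftInvariant_eq_smul μ' μ

/-- Integration over a finite-dimensional space as an iterated integral over two complementary
subspaces. -/
lemma exists_lintegral_eq_of_isCompl (μ : Measure E) [μ.IsAddHaarMeasure]
    {V W : Submodule ℝ E} (h : IsCompl V W) :
    ∃ c : ℝ≥0∞, c ≠ 0 ∧ c ≠ ⊤ ∧ ∀ f : E → ℝ≥0∞, Measurable f →
      ∫⁻ x, f x ∂μ = c * ∫⁻ w : W, ∫⁻ v : V, f (v + w) ∂Measure.addHaar ∂Measure.addHaar := by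
  set e : (V × W) ≃L[ℝ] E := (V.prodEquivOfIsCompl W h).toContinuousLinearEquiv with he
  obtain ⟨c, hc0, hc, hμ⟩ := exists_eq_smul_of_isAddHaarMeasure
    (((Measure.addHaar : Measure V).prod (Measure.addHaar : Measure W)).map e) μ
  refine ⟨c, hc0, hc, fun f hf ↦ ?_⟩
  have hem : Measurable e := e.continuous.measurable
  rw [hμ, lintegral_smul_measure, lintegral_map hf hem,
    lintegral_prod_symm' (fun z ↦ f (e z)) (hf.comp hem)]
  simp [he]

/-- Injective linear maps between spaces of the same dimension change integrals by a constant. -/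
lemma exists_lintegral_comp_linearEquiv {F : Type*} [NormedAddCommGroup F] [NormedSpace ℝ F]
    [FiniteDimensional ℝ F] [MeasurableSpace F] [BorelSpace F] (μ : Measure E) (ν : Measure F)
    [μ.IsAddHaarMeasure] [ν.IsAddHaarMeasure] (e : E ≃ₗ[ℝ] F) :
    ∃ c : ℝ≥0∞, c ≠ ⊤ ∧ ∀ f : F → ℝ≥0∞, Measurable f →
      ∫⁻ x, f (e x) ∂μ = c * ∫⁻ y, f y ∂ν := by
  obtain ⟨c, -, hc, hμ⟩ := exists_eq_smul_of_isAddHaarMeasure ν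
    (μ.map e.toContinuousLinearEquiv)
  refine ⟨c, hc, fun f hf ↦ ?_⟩
  have := lintegral_map (μ := μ) hf e.toContinuousLinearEquiv.continuous.measurable
  rw [hμ, lintegral_smul_measure] at this
  simpa using this.symm

end Haar

/-- The Brascamp–Lieb inequality holds with some finite constant. -/
def BLFinite {ι E : Type*} {F : ι → Type*} [Fintype ι] [AddCommGroup E] [Module ℝ E]
    [MeasurableSpace E] [∀ j, AddCommGroup (F j)] [∀ j, Module ℝ (F j)]
    [∀ j, MeasurableSpace (F j)] (L : ∀ j, E →ₗ[ℝ] F j) (p : ι → ℝ) (μ : Measure E)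
    (ν : ∀ j, Measure (F j)) : Prop :=
  ∃ C : ℝ≥0∞, C ≠ ⊤ ∧ ∀ f : ∀ j, F j → ℝ≥0∞, (∀ j, Measurable (f j)) →
    ∫⁻ x, ∏ j, f j (L j x) ^ p j ∂μ ≤ C * ∏ j, (∫⁻ y, f j y ∂ν j) ^ p j

/-- The scaling and dimension conditions for a Brascamp–Lieb datum. -/
structure BLCond {ι E : Type*} {F : ι → Type*} [Fintype ι] [AddCommGroup E] [Module ℝ E]
    [∀ j, AddCommGroup (F j)] [∀ j, Module ℝ (F j)] (L : ∀ j, E →ₗ[ℝ] F j) (p : ι → ℝ) :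
    Prop where
  nonneg : ∀ j, 0 ≤ p j
  scaling : ∑ j, p j * (Module.finrank ℝ (F j) : ℝ) = Module.finrank ℝ E
  dimension : ∀ V : Submodule ℝ E,
    (Module.finrank ℝ V : ℝ) ≤ ∑ j, p j * (Module.finrank ℝ (V.map (L j)) : ℝ)

/-- A positive finite family of affine functions, one of them decreasing, has a first zero. -/
lemma exists_first_zero {s : Set (ℝ × ℝ)} (hs : s.Finite) (hpos : ∀ c ∈ s, 0 < c.1)
    (hneg : ∃ c ∈ s, c.2 < 0) :
    ∃ t : ℝ, 0 < t ∧ (∀ c ∈ s, 0 ≤ c.1 + t * c.2) ∧ ∃ c ∈ s, c.1 + t * c.2 = 0 := by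
  obtain ⟨c, ⟨hc, hc2⟩, hmin⟩ := Set.exists_min_image {c ∈ s | c.2 < 0} (fun c ↦ c.1 / (-c.2))
    (hs.subset (Set.sep_subset _ _)) hneg
  have hc1 := hpos c hc
  have hc2' : c.2 ≠ 0 := hc2.ne
  have ht : 0 < c.1 / (-c.2) := div_pos hc1 (by linarith)
  refine ⟨c.1 / (-c.2), ht, fun a ha ↦ ?_, c, hc, by field_simp; ring⟩
  by_cases ha2 : a.2 < 0
  · have := (le_div_iff₀ (by linarith : 0 < -a.2)).1 (hmin a ⟨ha, ha2⟩)
    linarith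
  · have := hpos a ha
    have := mul_nonneg ht.le (not_lt.1 ha2)
    linarith

section Algebra

variable {ι E : Type*} {F : ι → Type*} [Fintype ι] [AddCommGroup E] [Module ℝ E]
  [∀ j, AddCommGroup (F j)] [∀ j, Module ℝ (F j)]
  {L : ∀ j, E →ₗ[ℝ] F j} {p : ι → ℝ}

/-- The map induced by `f` from a complement `W` of `V` to a complement `U` of `f V`. -/
noncomputable def complMap {E F : Type*} [AddCommGroup E] [Module ℝ E]
    [AddCommGroup F] [Module ℝ F] (f : E →ₗ[ℝ] F) {V : Submodule ℝ E} (W : Submodule ℝ E)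
    {U : Submodule ℝ F} (h : IsCompl (V.map f) U) : W →ₗ[ℝ] U :=
  U.projectionOnto (V.map f) h.symm ∘ₗ f ∘ₗ W.subtype

lemma exists_eq_add_complMap {E F : Type*} [AddCommGroup E] [Module ℝ E]
    [AddCommGroup F] [Module ℝ F] (f : E →ₗ[ℝ] F) {V W : Submodule ℝ E}
    {U : Submodule ℝ F} (h : IsCompl (V.map f) U) (w : W) :
    ∃ a : V.map f, f w = a + complMap f W h w :=
  ⟨(V.map f).projectionOnto U h (f w), by
    simpa [complMap] using (Submodule.projection_add_projection_eq_self h (f w)).symm⟩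

lemma complMap_surjective {E F : Type*} [AddCommGroup E] [Module ℝ E]
    [AddCommGroup F] [Module ℝ F] (f : E →ₗ[ℝ] F) (hf : Function.Surjective f)
    {V W : Submodule ℝ E} (hVW : IsCompl V W) {U : Submodule ℝ F} (h : IsCompl (V.map f) U) :
    Function.Surjective (complMap f W h) := by
  intro u
  obtain ⟨x, hx⟩ := hf u
  obtain ⟨⟨v, w⟩, rfl⟩ := (V.prodEquivOfIsCompl W hVW).surjective x
  refine ⟨w, ?_⟩
  have h0 : U.projectionOnto (V.map f) h.symm (f v) = 0 :=
    (Submodule.projectionOnto_apply_eq_zero_iff h.symm).2 (Submodule.mem_map_of_mem v.2)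
  have := congrArg (U.projectionOnto (V.map f) h.symm) hx
  simpa [h0, complMap] using this

lemma BLCond.restrict (h : BLCond L p) (V : Submodule ℝ E)
    (hV : ∑ j, p j * (Module.finrank ℝ (V.map (L j)) : ℝ) = Module.finrank ℝ V) :
    BLCond (fun j ↦ (L j).submoduleMap V) p where
  nonneg := h.nonneg
  scaling := hV
  dimension V' := by
    have := h.dimension (V'.map V.subtype)
    rw [Submodule.finrank_map_subtype_eq] at this
    refine this.trans_eq (Finset.sum_congr rfl fun j _ ↦ ?_)
    rw [← Submodule.finrank_map_subtype_eq _ (V'.map ((L j).submoduleMap V)),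
      ← Submodule.map_comp, ← Submodule.map_comp]
    rfl

lemma BLCond.compl [FiniteDimensional ℝ E] [∀ j, FiniteDimensional ℝ (F j)] (h : BLCond L p) {V W : Submodule ℝ E}
    (hV : ∑ j, p j * (Module.finrank ℝ (V.map (L j)) : ℝ) = Module.finrank ℝ V)
    (hVW : IsCompl V W) {U : ∀ j, Submodule ℝ (F j)} (hU : ∀ j, IsCompl (V.map (L j)) (U j)) :
    BLCond (fun j ↦ complMap (L j) W (hU j)) p where
  nonneg := h.nonneg
  scaling := by
    have h1 : (Module.finrank ℝ V : ℝ) + Module.finrank ℝ W = Module.finrank ℝ E := by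
      exact_mod_cast Submodule.finrank_add_eq_of_isCompl hVW
    have h2 : ∀ j, (Module.finrank ℝ (V.map (L j)) : ℝ) + Module.finrank ℝ (U j)
        = Module.finrank ℝ (F j) := fun j ↦ by
      exact_mod_cast Submodule.finrank_add_eq_of_isCompl (hU j)
    have h3 := h.scaling
    simp only [← h2, mul_add, Finset.sum_add_distrib] at h3
    linarith
  dimension W' := by
    set X := V ⊔ W'.map W.subtype with hX
    have h1 : (Module.finrank ℝ V : ℝ) + Module.finrank ℝ W' = Module.finrank ℝ X := by
      have hd : V ⊓ W'.map W.subtype = ⊥ :=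
        (hVW.disjoint.mono_right (Submodule.map_subtype_le W W')).eq_bot
      have := Submodule.finrank_sup_add_finrank_inf_eq V (W'.map W.subtype)
      rw [hd, finrank_bot, add_zero, Submodule.finrank_map_subtype_eq] at this
      exact_mod_cast this.symm
    have h2 : ∀ j, (Module.finrank ℝ (X.map (L j)) : ℝ) ≤ Module.finrank ℝ (V.map (L j))
        + Module.finrank ℝ (W'.map (complMap (L j) W (hU j))) := fun j ↦ by
      have hle : X.map (L j) ≤ V.map (L j) ⊔
          (W'.map (complMap (L j) W (hU j))).map (U j).subtype := by
        rw [hX, Submodule.map_sup]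
        refine sup_le le_sup_left ?_
        rintro _ ⟨_, ⟨w, hw, rfl⟩, rfl⟩
        obtain ⟨a, ha⟩ := exists_eq_add_complMap (L j) (hU j) w
        rw [Submodule.subtype_apply, ha]
        exact Submodule.add_mem_sup a.2 ⟨_, ⟨w, hw, rfl⟩, rfl⟩
      have := (Submodule.finrank_mono hle).trans (Submodule.finrank_add_le_finrank_add_finrank _ _)
      rw [Submodule.finrank_map_subtype_eq] at this
      exact_mod_cast this
    have h3 := h.dimension X
    have h4 := Finset.sum_le_sum fun j (_ : j ∈ Finset.univ) ↦
      mul_le_mul_of_nonneg_left (h2 j) (h.nonneg j)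
    simp only [mul_add, Finset.sum_add_distrib] at h4
    linarith

lemma finite_range_of_finrank [FiniteDimensional ℝ E] [∀ j, FiniteDimensional ℝ (F j)]
    (L : ∀ j, E →ₗ[ℝ] F j)
    (φ : ℕ × (ι → ℕ) → ℝ × ℝ) :
    (Set.range fun V : Submodule ℝ E ↦
      φ (Module.finrank ℝ V, fun j ↦ Module.finrank ℝ (V.map (L j)))).Finite := by
  classical
  have : (Set.Icc (0 : ℕ × (ι → ℕ))
      (Module.finrank ℝ E, fun j ↦ Module.finrank ℝ (F j))).Finite := Set.finite_Icc _ _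
  refine (this.image φ).subset ?_
  rintro _ ⟨V, rfl⟩
  exact ⟨_, ⟨by simp, V.finrank_le, fun j ↦ Submodule.finrank_le _⟩, rfl⟩

/-- The subspace `V` is proper, nontrivial, and attains equality in the dimension condition. -/
structure IsCritical (L : ∀ j, E →ₗ[ℝ] F j) (p : ι → ℝ) (V : Submodule ℝ E) : Prop where
  ne_bot : V ≠ ⊥
  ne_top : V ≠ ⊤
  eq : ∑ j, p j * (Module.finrank ℝ (V.map (L j)) : ℝ) = Module.finrank ℝ V

/-- The direction in exponent space that trades weight of `j` for weight of `i`, preserving the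
scaling condition. -/
noncomputable def tradeDir [DecidableEq ι] (F : ι → Type*) [∀ j, AddCommGroup (F j)]
    [∀ j, Module ℝ (F j)] (i j : ι) : ι → ℝ :=
  Pi.single i (Module.finrank ℝ (F i) : ℝ)⁻¹ - Pi.single j (Module.finrank ℝ (F j) : ℝ)⁻¹

lemma sum_tradeDir_mul [DecidableEq ι] (i j : ι) (a : ι → ℝ) :
    ∑ k, tradeDir F i j k * a k
      = (Module.finrank ℝ (F i) : ℝ)⁻¹ * a i - (Module.finrank ℝ (F j) : ℝ)⁻¹ * a j := by
  simp [tradeDir, sub_mul, Finset.sum_sub_distrib, Pi.single_apply, ite_mul]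

/-- In the absence of critical subspaces, weight can be traded until a weight vanishes or a
critical subspace appears. -/
lemma BLCond.exists_trade [DecidableEq ι] [FiniteDimensional ℝ E]
    [∀ j, FiniteDimensional ℝ (F j)] (h : BLCond L p) (hL : ∀ j, Function.Surjective (L j))
    (hcrit : ∀ V, ¬ IsCritical L p V) {i j : ι} (hij : i ≠ j)
    (hi : Module.finrank ℝ (F i) ≠ 0) (hpj : p j ≠ 0) (hj : Module.finrank ℝ (F j) ≠ 0) :
    ∃ t : ℝ, 0 < t ∧ BLCond L (p + t • tradeDir F i j) ∧
      ((p + t • tradeDir F i j) j = 0 ∨ ∃ V, IsCritical L (p + t • tradeDir F i j) V) := by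
  have hi' : (0 : ℝ) < Module.finrank ℝ (F i) := by exact_mod_cast Nat.pos_of_ne_zero hi
  have hj' : (0 : ℝ) < Module.finrank ℝ (F j) := by exact_mod_cast Nat.pos_of_ne_zero hj
  have hsum : ∀ (t : ℝ) (a : ι → ℝ), ∑ k, (p + t • tradeDir F i j) k * a k
      = ∑ k, p k * a k + t * ∑ k, tradeDir F i j k * a k := fun t a ↦ by
    simp [add_mul, Finset.sum_add_distrib, Finset.mul_sum, mul_assoc]
  let φ : ℕ × (ι → ℕ) → ℝ × ℝ := fun z ↦
    (∑ k, p k * (z.2 k : ℝ) - z.1, ∑ k, tradeDir F i j k * (z.2 k : ℝ))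
  let ψ : Submodule ℝ E → ℝ × ℝ := fun V ↦
    φ (Module.finrank ℝ V, fun k ↦ Module.finrank ℝ (V.map (L k)))
  obtain ⟨t, ht, hnn, c, hc, hc0⟩ := exists_first_zero
    (s := insert (p j, -(Module.finrank ℝ (F j) : ℝ)⁻¹) (ψ '' {V | V ≠ ⊥ ∧ V ≠ ⊤}))
    (((finite_range_of_finrank L φ).subset (Set.image_subset_range _ _)).insert _)
    (by
      rintro _ (rfl | ⟨V, ⟨hV, hV'⟩, rfl⟩)
      · exact (h.nonneg j).lt_of_ne' hpj
      · exact sub_pos.2 ((h.dimension V).lt_of_ne fun he ↦ hcrit V ⟨hV, hV', he.symm⟩))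
    ⟨_, Set.mem_insert _ _, neg_lt_zero.2 (inv_pos.2 hj')⟩
  have hqj : (p + t • tradeDir F i j) j = p j + t * -(Module.finrank ℝ (F j) : ℝ)⁻¹ := by
    simp [tradeDir, hij.symm]
  have hscal : ∑ k, (p + t • tradeDir F i j) k * (Module.finrank ℝ (F k) : ℝ)
      = Module.finrank ℝ E := by
    rw [hsum, sum_tradeDir_mul, inv_mul_cancel₀ hi'.ne', inv_mul_cancel₀ hj'.ne', sub_self,
      mul_zero, add_zero, h.scaling]
  refine ⟨t, ht, ⟨fun k ↦ ?_, hscal, fun V ↦ ?_⟩, ?_⟩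
  · by_cases hk : k = j
    · subst hk
      rw [hqj]
      exact hnn _ (Set.mem_insert _ _)
    · have h1 : tradeDir F i j k
        = (Pi.single i (Module.finrank ℝ (F i) : ℝ)⁻¹ : ι → ℝ) k := by
        simp [tradeDir, hk]
      have h2 : 0 ≤ tradeDir F i j k := by
        rw [h1]
        by_cases hki : k = i
        · subst hki
          simp
        · simp [hki]
      exact add_nonneg (h.nonneg k) (mul_nonneg ht.le h2)
  · by_cases hb : V = ⊥
    · have : ∀ k, Module.finrank ℝ (V.map (L k)) = 0 := fun k ↦ by
        rw [hb, Submodule.map_bot, finrank_bot]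
      simp [this, hb]
    by_cases hT : V = ⊤
    · subst hT
      have : ∀ k, Module.finrank ℝ ((⊤ : Submodule ℝ E).map (L k)) = Module.finrank ℝ (F k) :=
        fun k ↦ by rw [Submodule.map_top, LinearMap.range_eq_top.2 (hL k), finrank_top]
      simp only [this, finrank_top, hscal, le_refl]
    have := hnn (ψ V) (Set.mem_insert_of_mem _ ⟨V, ⟨hb, hT⟩, rfl⟩)
    rw [hsum]
    simp only [ψ, φ] at this
    linarith
  · rcases hc with rfl | ⟨V, ⟨hV, hV'⟩, rfl⟩
    · exact .inl (hqj.trans hc0)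
    · refine .inr ⟨V, hV, hV', ?_⟩
      rw [hsum]
      simp only [ψ, φ] at hc0
      linarith

end Algebra

section Finiteness

variable {ι E : Type*} {F : ι → Type*} [Fintype ι] [NormedAddCommGroup E] [NormedSpace ℝ E]
  [FiniteDimensional ℝ E] [MeasurableSpace E] [BorelSpace E]
  [∀ j, NormedAddCommGroup (F j)] [∀ j, NormedSpace ℝ (F j)] [∀ j, FiniteDimensional ℝ (F j)]
  [∀ j, MeasurableSpace (F j)] [∀ j, BorelSpace (F j)]
  {L : ∀ j, E →ₗ[ℝ] F j} {p : ι → ℝ}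

omit [∀ j, FiniteDimensional ℝ (F j)] in
lemma measurable_prod_comp (L : ∀ j, E →ₗ[ℝ] F j) (p : ι → ℝ) {f : ∀ j, F j → ℝ≥0∞}
    (hf : ∀ j, Measurable (f j)) : Measurable fun x ↦ ∏ j, f j (L j x) ^ p j :=
  Finset.measurable_fun_prod _ fun j _ ↦
    ((hf j).comp (L j).continuous_of_finiteDimensional.measurable).pow_const _

/-- Finiteness for the restrictions to a subspace and to a complement implies finiteness. -/
lemma BLFinite.of_isCompl (hp : ∀ j, 0 ≤ p j) (μ : Measure E) (ν : ∀ j, Measure (F j))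
    [μ.IsAddHaarMeasure] [∀ j, (ν j).IsAddHaarMeasure] {V W : Submodule ℝ E} (hVW : IsCompl V W)
    {U : ∀ j, Submodule ℝ (F j)} (hU : ∀ j, IsCompl (V.map (L j)) (U j))
    (hV : BLFinite (fun j ↦ (L j).submoduleMap V) p Measure.addHaar fun _ ↦ Measure.addHaar)
    (hW : BLFinite (fun j ↦ complMap (L j) W (hU j)) p Measure.addHaar
      fun _ ↦ Measure.addHaar) :
    BLFinite L p μ ν := by
  obtain ⟨c, -, hc, hμ⟩ := exists_lintegral_eq_of_isCompl μ hVW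
  choose b hb0 hb hν using fun j ↦ exists_lintegral_eq_of_isCompl (ν j) (hU j)
  obtain ⟨CV, hCV, hV⟩ := hV
  obtain ⟨CW, hCW, hW⟩ := hW
  refine ⟨c * (CV * (CW * ∏ j, ((b j)⁻¹) ^ p j)), ?_, fun f hf ↦ ?_⟩
  · refine ENNReal.mul_ne_top hc (ENNReal.mul_ne_top hCV (ENNReal.mul_ne_top hCW ?_))
    exact ENNReal.prod_ne_top fun j _ ↦
      ENNReal.rpow_ne_top_of_nonneg (hp j) (ENNReal.inv_ne_top.2 (hb0 j))
  set h : ∀ j, U j → ℝ≥0∞ := fun j u ↦ ∫⁻ a : V.map (L j), f j (a + u) ∂Measure.addHaar with hh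
  have hhm : ∀ j, Measurable (h j) := fun j ↦ by
    refine Measurable.lintegral_prod_left' (f := fun z : V.map (L j) × U j ↦ f j (z.1 + z.2)) ?_
    exact (hf j).comp ((measurable_subtype_coe.comp measurable_fst).add
      (measurable_subtype_coe.comp measurable_snd))
  have hhi : ∀ j, ∫⁻ u, h j u ∂Measure.addHaar = (b j)⁻¹ * ∫⁻ y, f j y ∂ν j := fun j ↦ by
    rw [hν j (f j) (hf j), ← mul_assoc, ENNReal.inv_mul_cancel (hb0 j) (hb j), one_mul]
  have inner : ∀ w : W, ∫⁻ v : V, ∏ j, f j (L j (v + w)) ^ p j ∂Measure.addHaar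
      ≤ CV * ∏ j, h j (complMap (L j) W (hU j) w) ^ p j := fun w ↦ by
    have := hV (fun j y ↦ f j (y + L j w))
      fun j ↦ (hf j).comp (measurable_subtype_coe.add_const _)
    simp only [map_add]
    refine this.trans_eq ?_
    congr 1
    refine Finset.prod_congr rfl fun j _ ↦ ?_
    congr 1
    obtain ⟨a, ha⟩ := exists_eq_add_complMap (L j) (hU j) w
    simp only [ha, ← add_assoc]
    exact lintegral_add_right_eq_self
      (fun y : V.map (L j) ↦ f j (y + complMap (L j) W (hU j) w)) a
  calc ∫⁻ x, ∏ j, f j (L j x) ^ p j ∂μ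
      = c * ∫⁻ w : W, ∫⁻ v : V, ∏ j, f j (L j (v + w)) ^ p j ∂Measure.addHaar
          ∂Measure.addHaar := hμ _ (measurable_prod_comp L p hf)
    _ ≤ c * ∫⁻ w : W, CV * ∏ j, h j (complMap (L j) W (hU j) w) ^ p j ∂Measure.addHaar := by
        gcongr with w
        exact inner w
    _ = c * (CV * ∫⁻ w : W, ∏ j, h j (complMap (L j) W (hU j) w) ^ p j ∂Measure.addHaar) := by
        rw [lintegral_const_mul _ (measurable_prod_comp _ p hhm)]
    _ ≤ c * (CV * (CW * ∏ j, (∫⁻ u, h j u ∂Measure.addHaar) ^ p j)) := by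
        gcongr
        exact hW h hhm
    _ = _ := by
        simp only [hhi, ENNReal.mul_rpow_of_nonneg _ _ (hp _), Finset.prod_mul_distrib, mul_assoc]

omit [∀ j, FiniteDimensional ℝ (F j)] in
/-- Finiteness of the Brascamp–Lieb constant is a convex condition on the exponents. -/
lemma BLFinite.interpolate {p₀ p₁ : ι → ℝ} (hp₀ : ∀ j, 0 ≤ p₀ j) (hp₁ : ∀ j, 0 ≤ p₁ j)
    {μ : Measure E} {ν : ∀ j, Measure (F j)} (h₀ : BLFinite L p₀ μ ν) (h₁ : BLFinite L p₁ μ ν)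
    {s t : ℝ} (hs : 0 ≤ s) (ht : 0 ≤ t) (hst : s + t = 1) :
    BLFinite L (fun j ↦ s * p₀ j + t * p₁ j) μ ν := by
  obtain ⟨C₀, hC₀, h₀⟩ := h₀
  obtain ⟨C₁, hC₁, h₁⟩ := h₁
  refine ⟨C₀ ^ s * C₁ ^ t, ENNReal.mul_ne_top (ENNReal.rpow_ne_top_of_nonneg hs hC₀)
    (ENNReal.rpow_ne_top_of_nonneg ht hC₁), fun f hf ↦ ?_⟩
  have key : ∀ a : ι → ℝ≥0∞, ∏ j, a j ^ (s * p₀ j + t * p₁ j)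
      = (∏ j, a j ^ p₀ j) ^ s * (∏ j, a j ^ p₁ j) ^ t := fun a ↦ by
    rw [← ENNReal.prod_rpow_of_nonneg hs, ← ENNReal.prod_rpow_of_nonneg ht,
      ← Finset.prod_mul_distrib]
    refine Finset.prod_congr rfl fun j _ ↦ ?_
    rw [ENNReal.rpow_add_of_nonneg _ _ (mul_nonneg hs (hp₀ j)) (mul_nonneg ht (hp₁ j)),
      mul_comm s, mul_comm t, ENNReal.rpow_mul, ENNReal.rpow_mul]
  simp only [key]
  calc _ ≤ (∫⁻ x, ∏ j, f j (L j x) ^ p₀ j ∂μ) ^ s * (∫⁻ x, ∏ j, f j (L j x) ^ p₁ j ∂μ) ^ t :=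
        ENNReal.lintegral_mul_norm_pow_le (measurable_prod_comp L p₀ hf).aemeasurable
          (measurable_prod_comp L p₁ hf).aemeasurable hs ht hst
    _ ≤ (C₀ * ∏ j, (∫⁻ y, f j y ∂ν j) ^ p₀ j) ^ s
          * (C₁ * ∏ j, (∫⁻ y, f j y ∂ν j) ^ p₁ j) ^ t := by
        gcongr
        · exact h₀ f hf
        · exact h₁ f hf
    _ = _ := by
        rw [ENNReal.mul_rpow_of_nonneg _ _ hs, ENNReal.mul_rpow_of_nonneg _ _ ht]
        ring

/-- A factor with zero exponent or zero-dimensional target is controlled pointwise. -/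
lemma exists_rpow_le_mul_lintegral_rpow {G : Type*} [NormedAddCommGroup G] [NormedSpace ℝ G]
    [FiniteDimensional ℝ G] [MeasurableSpace G] [BorelSpace G] (ν : Measure G)
    [ν.IsAddHaarMeasure] {q : ℝ} (hq : 0 ≤ q) (h : q = 0 ∨ Module.finrank ℝ G = 0) :
    ∃ c : ℝ≥0∞, c ≠ ⊤ ∧ ∀ (f : G → ℝ≥0∞) (y : G), f y ^ q ≤ c * (∫⁻ y, f y ∂ν) ^ q := by
  rcases h with rfl | h
  · exact ⟨1, by simp, by simp⟩
  have := Module.finrank_zero_iff.1 h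
  have h0 : ν Set.univ ≠ 0 := isOpen_univ.measure_ne_zero ν Set.univ_nonempty
  have hT : ν Set.univ ≠ ⊤ := (Set.toFinite (Set.univ : Set G)).isCompact.measure_ne_top
  refine ⟨((ν Set.univ)⁻¹) ^ q, ENNReal.rpow_ne_top_of_nonneg hq (ENNReal.inv_ne_top.2 h0),
    fun f y ↦ ?_⟩
  have hfy : f = fun _ ↦ f y := funext fun z ↦ by rw [Subsingleton.elim z y]
  rw [← ENNReal.mul_rpow_of_nonneg _ _ hq, hfy, lintegral_const, mul_comm (f y), ← mul_assoc,
    ENNReal.inv_mul_cancel h0 hT, one_mul]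

omit [BorelSpace E] in
/-- The Brascamp–Lieb inequality when the underlying space is trivial. -/
lemma BLFinite.of_finrank_eq_zero (hL : ∀ j, Function.Surjective (L j)) (hp : ∀ j, 0 ≤ p j)
    (μ : Measure E) (ν : ∀ j, Measure (F j)) [μ.IsAddHaarMeasure]
    [∀ j, (ν j).IsAddHaarMeasure] (hE : Module.finrank ℝ E = 0) : BLFinite L p μ ν := by
  have hE' := Module.finrank_zero_iff.1 hE
  have hF : ∀ j, Module.finrank ℝ (F j) = 0 := fun j ↦
    Nat.le_zero.1 (hE ▸ LinearMap.finrank_le_finrank_of_surjective (hL j))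
  choose c hc hcf using fun j ↦ exists_rpow_le_mul_lintegral_rpow (ν j) (hp j) (.inr (hF j))
  have hT : μ Set.univ ≠ ⊤ := (Set.toFinite (Set.univ : Set E)).isCompact.measure_ne_top
  refine ⟨(∏ j, c j) * μ Set.univ, ENNReal.mul_ne_top (ENNReal.prod_ne_top fun j _ ↦ hc j) hT,
    fun f _ ↦ ?_⟩
  calc ∫⁻ x, ∏ j, f j (L j x) ^ p j ∂μ
      ≤ ∫⁻ _, ∏ j, (c j * (∫⁻ y, f j y ∂ν j) ^ p j) ∂μ := by
        gcongr with x j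
        exact hcf j _ _
    _ = _ := by
        rw [lintegral_const, Finset.prod_mul_distrib]
        ring

/-- The Brascamp–Lieb inequality when only one factor is nontrivial. -/
lemma BLFinite.of_forall_ne (h : BLCond L p) (hL : ∀ j, Function.Surjective (L j))
    (μ : Measure E) (ν : ∀ j, Measure (F j)) [μ.IsAddHaarMeasure]
    [∀ j, (ν j).IsAddHaarMeasure] (hE : Module.finrank ℝ E ≠ 0) (i : ι)
    (hi : ∀ j, j ≠ i → p j = 0 ∨ Module.finrank ℝ (F j) = 0) : BLFinite L p μ ν := by
  classical
  have hsum : p i * (Module.finrank ℝ (F i) : ℝ) = Module.finrank ℝ E := by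
    rw [← h.scaling, Finset.sum_eq_single i (fun j _ hj ↦ by rcases hi j hj with h | h <;> simp [h])
      (by simp)]
  have hker : LinearMap.ker (L i) = ⊥ := by
    have h1 := h.dimension (LinearMap.ker (L i))
    rw [Finset.sum_eq_zero fun j _ ↦ ?_] at h1
    · exact Submodule.finrank_eq_zero.1 (by exact_mod_cast le_antisymm h1 (Nat.cast_nonneg _))
    · by_cases hj : j = i
      · subst hj
        have : (LinearMap.ker (L j)).map (L j) = ⊥ := by
          rw [eq_bot_iff]
          rintro _ ⟨x, hx, rfl⟩
          exact hx
        simp [this]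
      · rcases hi j hj with h | h
        · simp [h]
        · have := Submodule.finrank_le ((LinearMap.ker (L i)).map (L j))
          rw [h, Nat.le_zero] at this
          simp [this]
  let e : E ≃ₗ[ℝ] F i := LinearEquiv.ofBijective (L i) ⟨LinearMap.ker_eq_bot.1 hker, hL i⟩
  have hpi : p i = 1 := by
    rw [← e.finrank_eq] at hsum
    exact (mul_eq_right₀ (by exact_mod_cast hE)).1 hsum
  obtain ⟨b, hb, hbf⟩ := exists_lintegral_comp_linearEquiv μ (ν i) e
  choose c hc hcf using fun j : {j // j ≠ i} ↦
    exists_rpow_le_mul_lintegral_rpow (ν j) (h.nonneg j) (hi j j.2)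
  refine ⟨b * ∏ j, c j, ENNReal.mul_ne_top hb (ENNReal.prod_ne_top fun j _ ↦ hc j),
    fun f hf ↦ ?_⟩
  have split : ∀ a : ι → ℝ≥0∞, ∏ j, a j = a i * ∏ j : {j // j ≠ i}, a j := fun a ↦ by
    rw [← Finset.mul_prod_erase Finset.univ a (Finset.mem_univ i),
      ← Finset.prod_subtype (Finset.univ.erase i) (by simp) a]
  calc ∫⁻ x, ∏ j, f j (L j x) ^ p j ∂μ
      ≤ ∫⁻ x, f i (e x) * ∏ j : {j // j ≠ i}, (c j * (∫⁻ y, f j y ∂ν j) ^ p j) ∂μ := by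
        gcongr with x
        rw [split, hpi, ENNReal.rpow_one]
        gcongr with j
        · exact le_rfl
        · exact hcf j _ _
    _ = (b * ∫⁻ y, f i y ∂ν i) *
          ∏ j : {j // j ≠ i}, (c j * (∫⁻ y, f j y ∂ν j) ^ p j) := by
        have hm : Measurable fun x ↦ f i (e x) :=
          (hf i).comp (L i).continuous_of_finiteDimensional.measurable
        rw [lintegral_mul_const _ hm, hbf _ (hf i)]
    _ = _ := by
        rw [split, hpi, ENNReal.rpow_one, Finset.prod_mul_distrib]
        ring

end Finiteness

section Sufficiency

universe u v

/-- If finiteness holds whenever there is a critical subspace, it always holds. -/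
lemma BLCond.blFinite_of_critical {ι E : Type*} {F : ι → Type*} [Fintype ι]
    [NormedAddCommGroup E] [NormedSpace ℝ E] [FiniteDimensional ℝ E] [MeasurableSpace E]
    [BorelSpace E] [∀ j, NormedAddCommGroup (F j)] [∀ j, NormedSpace ℝ (F j)]
    [∀ j, FiniteDimensional ℝ (F j)] [∀ j, MeasurableSpace (F j)] [∀ j, BorelSpace (F j)]
    {L : ∀ j, E →ₗ[ℝ] F j} (hL : ∀ j, Function.Surjective (L j)) (μ : Measure E)
    (ν : ∀ j, Measure (F j)) [μ.IsAddHaarMeasure] [∀ j, (ν j).IsAddHaarMeasure]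
    (hcrit : ∀ q V, BLCond L q → IsCritical L q V → BLFinite L q μ ν)
    {p : ι → ℝ} (h : BLCond L p) : BLFinite L p μ ν := by
  classical
  by_cases hE : Module.finrank ℝ E = 0
  · exact .of_finrank_eq_zero hL h.nonneg μ ν hE
  let S : (ι → ℝ) → Finset ι := fun q ↦ {k | q k ≠ 0 ∧ Module.finrank ℝ (F k) ≠ 0}
  induction hn : (S p).card using Nat.strong_induction_on generalizing p with
  | _ n ih =>
  subst hn
  by_cases hc : ∃ V, IsCritical L p V
  · obtain ⟨V, hV⟩ := hc
    exact hcrit p V h hV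
  push Not at hc
  rcases Nat.lt_or_ge 1 (S p).card with hcard | hcard
  · obtain ⟨i, hi, j, hj, hij⟩ := Finset.one_lt_card.1 hcard
    have hi' := (Finset.mem_filter.1 hi).2
    have hj' := (Finset.mem_filter.1 hj).2
    have key : ∀ {i j : ι}, i ≠ j → i ∈ S p → j ∈ S p →
        ∃ t : ℝ, 0 < t ∧ (∀ k, 0 ≤ (p + t • tradeDir F i j) k) ∧
          BLFinite L (p + t • tradeDir F i j) μ ν := by
      intro i j hij hi hj
      have hi' := (Finset.mem_filter.1 hi).2
      have hj' := (Finset.mem_filter.1 hj).2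
      obtain ⟨t, ht, hq, hq0 | ⟨V, hV⟩⟩ := h.exists_trade hL hc hij hi'.2 hj'.1 hj'.2
      · refine ⟨t, ht, hq.nonneg, ih _ (Finset.card_lt_card ?_) hq rfl⟩
        refine Finset.ssubset_iff_subset_ne.2 ⟨fun k hk ↦ ?_, fun he ↦ ?_⟩
        · have hk' := (Finset.mem_filter.1 hk).2
          by_cases hki : k = i
          · exact hki ▸ hi
          by_cases hkj : k = j
          · exact hkj ▸ hj
          simpa [S, tradeDir, hki, hkj] using hk
        · rw [← he] at hj
          exact (Finset.mem_filter.1 hj).2.1 hq0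
      · exact ⟨t, ht, hq.nonneg, hcrit _ V hq hV⟩
    obtain ⟨t, ht, htn, hft⟩ := key hij hi hj
    obtain ⟨s, hs, hsn, hfs⟩ := key hij.symm hj hi
    have hst : 0 < s + t := add_pos hs ht
    have := BLFinite.interpolate htn hsn hft hfs (div_pos hs hst).le (div_pos ht hst).le
      (by field_simp)
    convert this using 2 with k
    simp only [Pi.add_apply, Pi.smul_apply, smul_eq_mul, tradeDir, Pi.sub_apply]
    field_simp
    ring
  · obtain ⟨i, hi⟩ : ∃ i, S p ⊆ {i} := by
      by_contra! hne
      have hempty : S p = ∅ := by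
        rcases (S p).eq_empty_or_nonempty with h0 | ⟨i, hi⟩
        · exact h0
        · exact absurd (fun k hk ↦ Finset.mem_singleton.2 (Finset.card_le_one.1 hcard k hk i hi))
            (hne i)
      refine hE ?_
      have := h.scaling
      rw [Finset.sum_eq_zero fun k _ ↦ ?_] at this
      · exact_mod_cast this.symm
      · have hk : k ∉ S p := by simp [hempty]
        simp only [S, Finset.mem_filter, Finset.mem_univ, true_and, not_and_or, not_not] at hk
        rcases hk with hk | hk <;> simp [hk]
    refine .of_forall_ne h hL μ ν hE i fun k hk ↦ ?_
    have hk' : k ∉ S p := fun hkS ↦ hk (Finset.mem_singleton.1 (hi hkS))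
    simpa [S, not_and_or, -not_and] using hk'

/-- The scaling and dimension conditions imply the Brascamp–Lieb inequality. -/
theorem BLCond.blFinite {ι : Type*} [Fintype ι] {E : Type u} {F : ι → Type v}
    [NormedAddCommGroup E] [NormedSpace ℝ E] [FiniteDimensional ℝ E] [MeasurableSpace E]
    [BorelSpace E] [∀ j, NormedAddCommGroup (F j)] [∀ j, NormedSpace ℝ (F j)]
    [∀ j, FiniteDimensional ℝ (F j)] [∀ j, MeasurableSpace (F j)] [∀ j, BorelSpace (F j)]
    {L : ∀ j, E →ₗ[ℝ] F j} (hL : ∀ j, Function.Surjective (L j)) (μ : Measure E)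
    (ν : ∀ j, Measure (F j)) [μ.IsAddHaarMeasure] [∀ j, (ν j).IsAddHaarMeasure]
    {p : ι → ℝ} (h : BLCond L p) : BLFinite L p μ ν := by
  induction hn : Module.finrank ℝ E using Nat.strong_induction_on generalizing E F p with
  | _ n ih =>
  subst hn
  refine BLCond.blFinite_of_critical hL μ ν (fun q V hq hV ↦ ?_) h
  obtain ⟨W, hVW⟩ := V.exists_isCompl
  choose U hU using fun j ↦ (V.map (L j)).exists_isCompl
  have hWt : W ≠ ⊤ := fun hW ↦ hV.ne_bot (by simpa [hW] using hVW.disjoint)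
  refine .of_isCompl hq.nonneg μ ν hVW hU ?_ ?_
  · exact ih _ (Submodule.finrank_lt hV.ne_top)
      (fun j ↦ (L j).submoduleMap_surjective V) _ _ (hq.restrict V hV.eq) rfl
  · exact ih _ (Submodule.finrank_lt hWt)
      (fun j ↦ complMap_surjective (L j) (hL j) hVW (hU j)) _ _ (hq.compl hV.eq hVW hU) rfl

end Sufficiency

section Necessity

/-- The box of points whose components along complementary subspaces are bounded by `R`, `r`. -/
def complBox {E : Type*} [NormedAddCommGroup E] [NormedSpace ℝ E] {V W : Submodule ℝ E}
    (h : IsCompl V W) (R r : ℝ) : Set E :=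
  {x | ‖V.projectionOnto W h x‖ ≤ R ∧ ‖W.projectionOnto V h.symm x‖ ≤ r}

variable {E F : Type*} [NormedAddCommGroup E] [NormedSpace ℝ E] [FiniteDimensional ℝ E]
  [NormedAddCommGroup F] [NormedSpace ℝ F] [FiniteDimensional ℝ F]

lemma measurableSet_complBox [MeasurableSpace E] [BorelSpace E] {V W : Submodule ℝ E}
    (h : IsCompl V W) (R r : ℝ) : MeasurableSet (complBox h R r) := by
  have h1 : Continuous fun x ↦ ‖V.projectionOnto W h x‖ :=
    (V.projectionOnto W h).continuous_of_finiteDimensional.norm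
  have h2 : Continuous fun x ↦ ‖W.projectionOnto V h.symm x‖ :=
    (W.projectionOnto V h.symm).continuous_of_finiteDimensional.norm
  exact ((isClosed_le h1 continuous_const).inter
    (isClosed_le h2 continuous_const)).measurableSet

lemma exists_measure_complBox [MeasurableSpace E] [BorelSpace E] (μ : Measure E)
    [μ.IsAddHaarMeasure] {V W : Submodule ℝ E} (h : IsCompl V W) :
    ∃ κ : ℝ≥0∞, κ ≠ 0 ∧ κ ≠ ⊤ ∧ ∀ R r : ℝ, 0 ≤ R → 0 ≤ r → μ (complBox h R r)
      = κ * ENNReal.ofReal (R ^ Module.finrank ℝ V * r ^ Module.finrank ℝ W) := by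
  obtain ⟨c, hc0, hc, hμ⟩ := exists_lintegral_eq_of_isCompl μ h
  set a : ℝ≥0∞ := (Measure.addHaar : Measure V) (Metric.ball 0 1) with ha
  set b : ℝ≥0∞ := (Measure.addHaar : Measure W) (Metric.ball 0 1) with hb
  have ha0 : a ≠ 0 := (Metric.measure_ball_pos _ _ one_pos).ne'
  have hb0 : b ≠ 0 := (Metric.measure_ball_pos _ _ one_pos).ne'
  have haT : a ≠ ⊤ := measure_ball_lt_top.ne
  have hbT : b ≠ ⊤ := measure_ball_lt_top.ne
  refine ⟨c * (a * b), mul_ne_zero hc0 (mul_ne_zero ha0 hb0),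
    ENNReal.mul_ne_top hc (ENNReal.mul_ne_top haT hbT), fun R r hR hr ↦ ?_⟩
  have hfun : ∀ (v : V) (w : W), (complBox h R r).indicator (1 : E → ℝ≥0∞) (v + w)
      = (Metric.closedBall (0 : V) R).indicator 1 v
        * (Metric.closedBall (0 : W) r).indicator 1 w := fun v w ↦ by
    have hmem : (v : E) + w ∈ complBox h R r ↔ ‖v‖ ≤ R ∧ ‖w‖ ≤ r := by simp [complBox]
    by_cases hv : ‖v‖ ≤ R <;> by_cases hw : ‖w‖ ≤ r <;>
      simp [Set.indicator, hmem, hv, hw, -Submodule.coe_norm]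
  rw [← lintegral_indicator_one (measurableSet_complBox h R r),
    hμ _ (measurable_one.indicator (measurableSet_complBox h R r))]
  simp only [hfun]
  have h1 : ∀ w : W, ∫⁻ v : V, (Metric.closedBall (0 : V) R).indicator 1 v
      * (Metric.closedBall (0 : W) r).indicator 1 w ∂Measure.addHaar
      = (Measure.addHaar : Measure V) (Metric.closedBall 0 R)
        * (Metric.closedBall (0 : W) r).indicator 1 w := fun w ↦ by
    rw [lintegral_mul_const _ (measurable_one.indicator Metric.isClosed_closedBall.measurableSet),
      lintegral_indicator_one Metric.isClosed_closedBall.measurableSet]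
  simp only [h1]
  rw [lintegral_const_mul _ (measurable_one.indicator Metric.isClosed_closedBall.measurableSet),
    lintegral_indicator_one Metric.isClosed_closedBall.measurableSet,
    Measure.addHaar_closedBall _ _ hR, Measure.addHaar_closedBall _ _ hr,
    ENNReal.ofReal_mul (by positivity)]
  ring

omit [FiniteDimensional ℝ F] in
/-- A linear map sends boxes adapted to `V` into comparable boxes adapted to the image of `V`. -/
lemma exists_mapsTo_complBox (f : E →ₗ[ℝ] F) {V W : Submodule ℝ E} (h : IsCompl V W)
    {U : Submodule ℝ F} (hU : IsCompl (V.map f) U) :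
    ∃ c : ℝ, 0 < c ∧ ∀ R r : ℝ, 0 ≤ r → r ≤ R →
      Set.MapsTo f (complBox h R r) (complBox hU (c * R) (c * r)) := by
  have bound : ∀ {A B : Type _} [NormedAddCommGroup A] [NormedSpace ℝ A] [FiniteDimensional ℝ A]
      [NormedAddCommGroup B] [NormedSpace ℝ B] (g : A →ₗ[ℝ] B),
      ∃ c : ℝ, 0 ≤ c ∧ ∀ x, ‖g x‖ ≤ c * ‖x‖ := fun g ↦
    ⟨_, norm_nonneg (LinearMap.toContinuousLinearMap g),
      (LinearMap.toContinuousLinearMap g).le_opNorm⟩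
  obtain ⟨c₁, hc₁, h₁⟩ := bound ((V.map f).projectionOnto U hU ∘ₗ f ∘ₗ V.subtype)
  obtain ⟨c₂, hc₂, h₂⟩ := bound ((V.map f).projectionOnto U hU ∘ₗ f ∘ₗ W.subtype)
  obtain ⟨c₃, hc₃, h₃⟩ := bound (complMap f W hU)
  refine ⟨c₁ + c₂ + c₃ + 1, by positivity, fun R r hr hrR x hx ↦ ?_⟩
  obtain ⟨⟨v, w⟩, rfl⟩ := (V.prodEquivOfIsCompl W h).surjective x
  obtain ⟨hv, hw⟩ := hx
  simp only [Submodule.coe_prodEquivOfIsCompl', map_add, Submodule.projectionOnto_apply_left,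
    Submodule.projectionOnto_apply_right, add_zero, zero_add] at hv hw
  have h0 : U.projectionOnto (V.map f) hU.symm (f v) = 0 :=
    (Submodule.projectionOnto_apply_eq_zero_iff hU.symm).2 (Submodule.mem_map_of_mem v.2)
  have hR : 0 ≤ R := hr.trans hrR
  refine ⟨?_, ?_⟩
  · simp only [Submodule.coe_prodEquivOfIsCompl', map_add]
    calc _ ≤ c₁ * ‖v‖ + c₂ * ‖w‖ := (norm_add_le _ _).trans (add_le_add (h₁ v) (h₂ w))
      _ ≤ c₁ * R + c₂ * R := by gcongr; exact hw.trans hrR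
      _ ≤ _ := by nlinarith [mul_nonneg hc₃ hR]
  · simp only [Submodule.coe_prodEquivOfIsCompl', map_add, h0, zero_add]
    calc _ ≤ c₃ * ‖w‖ := h₃ w
      _ ≤ c₃ * r := by gcongr
      _ ≤ _ := by nlinarith [mul_nonneg hc₁ hr, mul_nonneg hc₂ hr]

/-- Comparison of power growth rates. -/
lemma le_of_forall_rpow_le {a b K : ℝ} (h : ∀ R : ℝ, 1 ≤ R → R ^ a ≤ K * R ^ b) : a ≤ b := by
  by_contra! hab
  have hlim := tendsto_rpow_atTop (sub_pos.2 hab)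
  obtain ⟨R, hR, hR1⟩ := ((hlim.eventually_gt_atTop K).and
    (Filter.eventually_ge_atTop 1)).exists
  have hRpos : 0 < R := one_pos.trans_le hR1
  have := h R hR1
  rw [Real.rpow_sub hRpos, lt_div_iff₀ (Real.rpow_pos_of_pos hRpos b)] at hR
  linarith

/-- Testing the Brascamp–Lieb inequality on boxes adapted to a subspace. -/
lemma exists_rpow_mul_rpow_le {ι : Type*} [Fintype ι] {F : ι → Type*}
    [MeasurableSpace E] [BorelSpace E] [∀ j, NormedAddCommGroup (F j)]
    [∀ j, NormedSpace ℝ (F j)] [∀ j, FiniteDimensional ℝ (F j)] [∀ j, MeasurableSpace (F j)]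
    [∀ j, BorelSpace (F j)] {L : ∀ j, E →ₗ[ℝ] F j} {p : ι → ℝ} (hp : ∀ j, 0 ≤ p j)
    (μ : Measure E) (ν : ∀ j, Measure (F j)) [μ.IsAddHaarMeasure]
    [∀ j, (ν j).IsAddHaarMeasure] {C : ℝ≥0∞} (hC : C ≠ ⊤)
    (h : ∀ f : ∀ j, F j → ℝ≥0∞, (∀ j, Measurable (f j)) → (∀ j, ∫⁻ y, f j y ∂ν j ≠ 0) →
      (∀ j, ∫⁻ y, f j y ∂ν j ≠ ⊤) →
      ∫⁻ x, ∏ j, f j (L j x) ^ p j ∂μ ≤ C * ∏ j, (∫⁻ y, f j y ∂ν j) ^ p j)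
    {V W : Submodule ℝ E} (hVW : IsCompl V W) {U : ∀ j, Submodule ℝ (F j)}
    (hU : ∀ j, IsCompl (V.map (L j)) (U j)) :
    ∃ K : ℝ, ∀ R r : ℝ, 0 < r → r ≤ R →
      R ^ (Module.finrank ℝ V : ℝ) * r ^ (Module.finrank ℝ W : ℝ)
        ≤ K * (R ^ (∑ j, p j * (Module.finrank ℝ (V.map (L j)) : ℝ))
          * r ^ (∑ j, p j * (Module.finrank ℝ (U j) : ℝ))) := by
  obtain ⟨κ, hκ0, hκ, hμ⟩ := exists_measure_complBox μ hVW
  choose κ' hκ0' hκ' hν using fun j ↦ exists_measure_complBox (ν j) (hU j)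
  choose c hc hmaps using fun j ↦ exists_mapsTo_complBox (L j) hVW (hU j)
  have hDT : C * ∏ j, κ' j ^ p j ≠ ⊤ := ENNReal.mul_ne_top hC
    (ENNReal.prod_ne_top fun j _ ↦ ENNReal.rpow_ne_top_of_nonneg (hp j) (hκ' j))
  refine ⟨(κ⁻¹ * (C * ∏ j, κ' j ^ p j)).toReal * ∏ j,
    (c j ^ Module.finrank ℝ (V.map (L j)) * c j ^ Module.finrank ℝ (U j)) ^ p j,
    fun R r hr hrR ↦ ?_⟩
  have hR : 0 < R := hr.trans_le hrR
  set B : ∀ j, Set (F j) := fun j ↦ complBox (hU j) (c j * R) (c j * r) with hB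
  set X : ι → ℝ := fun j ↦ (c j * R) ^ Module.finrank ℝ (V.map (L j))
    * (c j * r) ^ Module.finrank ℝ (U j) with hX
  have hXpos : ∀ j, 0 < X j := fun j ↦ by have := hc j; positivity
  have hBm : ∀ j, MeasurableSet (B j) := fun j ↦ measurableSet_complBox _ _ _
  have hBν : ∀ j, ν j (B j) = κ' j * ENNReal.ofReal (X j) := fun j ↦
    hν j _ _ (mul_pos (hc j) hR).le (mul_pos (hc j) hr).le
  have hBi : ∀ j, ∫⁻ y, (B j).indicator (1 : F j → ℝ≥0∞) y ∂ν j
      = κ' j * ENNReal.ofReal (X j) := fun j ↦ by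
    rw [lintegral_indicator_one (hBm j), hBν]
  have key := h (fun j ↦ (B j).indicator 1) (fun j ↦ measurable_one.indicator (hBm j))
    (fun j ↦ by
      rw [hBi]
      exact mul_ne_zero (hκ0' j) (ENNReal.ofReal_pos.2 (hXpos j)).ne')
    (fun j ↦ by
      rw [hBi]
      exact ENNReal.mul_ne_top (hκ' j) ENNReal.ofReal_ne_top)
  have hlow : μ (complBox hVW R r)
      ≤ ∫⁻ x, ∏ j, (B j).indicator (1 : F j → ℝ≥0∞) (L j x) ^ p j ∂μ := by
    rw [← lintegral_indicator_one (measurableSet_complBox hVW R r)]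
    refine lintegral_mono fun x ↦ ?_
    by_cases hx : x ∈ complBox hVW R r
    · have : ∀ j, L j x ∈ B j := fun j ↦ hmaps j R r hr.le hrR hx
      simp [hx, this]
    · simp [hx]
  have hprod : ∏ j, (κ' j * ENNReal.ofReal (X j)) ^ p j
      = (∏ j, κ' j ^ p j) * ENNReal.ofReal (∏ j, X j ^ p j) := by
    rw [ENNReal.ofReal_prod_of_nonneg fun j _ ↦ Real.rpow_nonneg (hXpos j).le _,
      ← Finset.prod_mul_distrib]
    refine Finset.prod_congr rfl fun j _ ↦ ?_
    rw [ENNReal.mul_rpow_of_nonneg _ _ (hp j),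
      ENNReal.ofReal_rpow_of_nonneg (hXpos j).le (hp j)]
  have hXprod : ∏ j, X j ^ p j = (∏ j, (c j ^ Module.finrank ℝ (V.map (L j))
        * c j ^ Module.finrank ℝ (U j)) ^ p j)
      * (R ^ (∑ j, p j * (Module.finrank ℝ (V.map (L j)) : ℝ))
          * r ^ (∑ j, p j * (Module.finrank ℝ (U j) : ℝ))) := by
    rw [Real.rpow_sum_of_pos hR, Real.rpow_sum_of_pos hr, ← Finset.prod_mul_distrib,
      ← Finset.prod_mul_distrib]
    refine Finset.prod_congr rfl fun j _ ↦ ?_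
    have := hc j
    rw [mul_comm (p j), mul_comm (p j), Real.rpow_mul hR.le, Real.rpow_mul hr.le,
      Real.rpow_natCast, Real.rpow_natCast, ← Real.mul_rpow (by positivity) (by positivity),
      ← Real.mul_rpow (by positivity) (by positivity), hX]
    congr 1
    simp only [mul_pow]
    ring
  have hfin := hlow.trans key
  simp only [hBi] at hfin
  rw [hμ R r hR.le hr.le, hprod, ← mul_assoc] at hfin
  have hfin' : ENNReal.ofReal (R ^ Module.finrank ℝ V * r ^ Module.finrank ℝ W)
      ≤ κ⁻¹ * (C * ∏ j, κ' j ^ p j) * ENNReal.ofReal (∏ j, X j ^ p j) := by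
    calc _ = κ⁻¹ * (κ * ENNReal.ofReal (R ^ Module.finrank ℝ V * r ^ Module.finrank ℝ W)) := by
          rw [← mul_assoc, ENNReal.inv_mul_cancel hκ0 hκ, one_mul]
      _ ≤ κ⁻¹ * (C * (∏ j, κ' j ^ p j) * ENNReal.ofReal (∏ j, X j ^ p j)) := by gcongr
      _ = _ := by rw [mul_assoc κ⁻¹]
  have hT : κ⁻¹ * (C * ∏ j, κ' j ^ p j) ≠ ⊤ :=
    ENNReal.mul_ne_top (ENNReal.inv_ne_top.2 hκ0) hDT
  have hXn : 0 ≤ ∏ j, X j ^ p j :=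
    Finset.prod_nonneg fun j _ ↦ Real.rpow_nonneg (hXpos j).le _
  have hreal := ENNReal.toReal_mono (ENNReal.mul_ne_top hT ENNReal.ofReal_ne_top) hfin'
  rw [ENNReal.toReal_mul, ENNReal.toReal_ofReal hXn, ENNReal.toReal_ofReal (by positivity),
    hXprod, ← mul_assoc] at hreal
  simpa only [Real.rpow_natCast] using hreal

/-- The scaling and dimension conditions are necessary for the Brascamp–Lieb inequality. -/
lemma BLCond.of_forall_le {ι : Type*} [Fintype ι] {F : ι → Type*}
    [MeasurableSpace E] [BorelSpace E] [∀ j, NormedAddCommGroup (F j)]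
    [∀ j, NormedSpace ℝ (F j)] [∀ j, FiniteDimensional ℝ (F j)] [∀ j, MeasurableSpace (F j)]
    [∀ j, BorelSpace (F j)] {L : ∀ j, E →ₗ[ℝ] F j} {p : ι → ℝ} (hp : ∀ j, 0 ≤ p j)
    (hL : ∀ j, Function.Surjective (L j))
    (μ : Measure E) (ν : ∀ j, Measure (F j)) [μ.IsAddHaarMeasure]
    [∀ j, (ν j).IsAddHaarMeasure] {C : ℝ≥0∞} (hC : C ≠ ⊤)
    (h : ∀ f : ∀ j, F j → ℝ≥0∞, (∀ j, Measurable (f j)) → (∀ j, ∫⁻ y, f j y ∂ν j ≠ 0) →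
      (∀ j, ∫⁻ y, f j y ∂ν j ≠ ⊤) →
      ∫⁻ x, ∏ j, f j (L j x) ^ p j ∂μ ≤ C * ∏ j, (∫⁻ y, f j y ∂ν j) ^ p j) :
    BLCond L p := by
  have hdim : ∀ V : Submodule ℝ E, (Module.finrank ℝ V : ℝ)
      ≤ ∑ j, p j * (Module.finrank ℝ (V.map (L j)) : ℝ) := fun V ↦ by
    obtain ⟨W, hVW⟩ := V.exists_isCompl
    choose U hU using fun j ↦ (V.map (L j)).exists_isCompl
    obtain ⟨K, hK⟩ := exists_rpow_mul_rpow_le hp μ ν hC h hVW hU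
    exact le_of_forall_rpow_le (K := K) fun R hR ↦ by simpa using hK R 1 one_pos hR
  refine ⟨hp, le_antisymm ?_ ?_, hdim⟩
  · have hU : ∀ j, IsCompl ((⊥ : Submodule ℝ E).map (L j)) ⊤ := fun j ↦ by
      rw [Submodule.map_bot]
      exact isCompl_bot_top
    obtain ⟨K, hK⟩ := exists_rpow_mul_rpow_le hp μ ν hC h (isCompl_bot_top (α := Submodule ℝ E)) hU
    refine le_of_forall_rpow_le (K := K) fun R hR ↦ ?_
    have hRpos : 0 < R := one_pos.trans_le hR
    have := hK 1 R⁻¹ (inv_pos.2 hRpos) (inv_le_one_of_one_le₀ hR)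
    simp only [Real.one_rpow, one_mul, finrank_top, Real.inv_rpow hRpos.le] at this
    rw [inv_le_iff_one_le_mul₀ (Real.rpow_pos_of_pos hRpos _)] at this
    have hpos := Real.rpow_pos_of_pos hRpos
      (∑ j, p j * (Module.finrank ℝ (F j) : ℝ))
    field_simp at this
    linarith
  · have htop := hdim ⊤
    have : ∀ j, Module.finrank ℝ ((⊤ : Submodule ℝ E).map (L j)) = Module.finrank ℝ (F j) :=
      fun j ↦ by rw [Submodule.map_top, LinearMap.range_eq_top.2 (hL j), finrank_top]
    simpa only [this, finrank_top] using htop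

end Necessity

/-- The defining inequality of the Brascamp–Lieb constant, without normalization. -/
lemma lintegral_prod_le_BLconst_mul {k d : ℕ} {dj : Fin k → ℕ}
    (L : (j : Fin k) → EuclideanSpace ℝ (Fin d) →ₗ[ℝ] EuclideanSpace ℝ (Fin (dj j)))
    {p : Fin k → ℝ} (hp : ∀ j, 0 ≤ p j) (f : ∀ j, EuclideanSpace ℝ (Fin (dj j)) → ℝ≥0∞)
    (hf : ∀ j, Measurable (f j)) (h0 : ∀ j, ∫⁻ y, f j y ≠ 0) (hT : ∀ j, ∫⁻ y, f j y ≠ ⊤) :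
    ∫⁻ x, ∏ j, f j (L j x) ^ p j ≤ BLconst L p * ∏ j, (∫⁻ y, f j y) ^ p j := by
  set m : Fin k → ℝ≥0∞ := fun j ↦ ∫⁻ y, f j y with hm
  set g : ∀ j, EuclideanSpace ℝ (Fin (dj j)) → ℝ≥0∞ := fun j y ↦ (m j)⁻¹ * f j y with hg
  have hgm : ∀ j, Measurable (g j) := fun j ↦ (hf j).const_mul _
  have hgi : ∀ j, ∫⁻ y, g j y = 1 := fun j ↦ by
    rw [hg, lintegral_const_mul _ (hf j)]
    exact ENNReal.inv_mul_cancel (h0 j) (hT j)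
  have hfg : ∀ x, ∏ j, f j (L j x) ^ p j
      = (∏ j, m j ^ p j) * ∏ j, g j (L j x) ^ p j := fun x ↦ by
    rw [← Finset.prod_mul_distrib]
    refine Finset.prod_congr rfl fun j _ ↦ ?_
    rw [← ENNReal.mul_rpow_of_nonneg _ _ (hp j), hg, ← mul_assoc,
      ENNReal.mul_inv_cancel (h0 j) (hT j), one_mul]
  simp only [hfg]
  rw [lintegral_const_mul _ (measurable_prod_comp L p hgm), mul_comm]
  gcongr
  exact le_iSup_of_le g (le_iSup_of_le hgm (le_iSup_of_le hgi le_rfl))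

/-- The Bennett–Carbery–Christ–Tao finiteness criterion for the Brascamp–Lieb constant:
for surjective linear maps `L_j : ℝ^d → ℝ^{d_j}` and exponents `p_j ≥ 0`,
`BL(L,p) < ∞` if and only if `∑_j p_j d_j = d` and
`dim V ≤ ∑_j p_j dim(L_j V)` for every subspace `V ⊆ ℝ^d`. -/
theorem brascamp_lieb_finiteness (k d : ℕ) (dj : Fin k → ℕ)
    (L : (j : Fin k) → EuclideanSpace ℝ (Fin d) →ₗ[ℝ] EuclideanSpace ℝ (Fin (dj j)))
    (hL : ∀ j, Function.Surjective (L j)) (p : Fin k → ℝ) (hp : ∀ j, 0 ≤ p j) :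
    BLconst L p < ⊤ ↔
      ((∑ j, p j * (dj j : ℝ)) = d ∧
        ∀ V : Submodule ℝ (EuclideanSpace ℝ (Fin d)),
          (Module.finrank ℝ V : ℝ) ≤
            ∑ j, p j * (Module.finrank ℝ (V.map (L j)) : ℝ)) := by
  constructor
  · intro h
    have := BLCond.of_forall_le hp hL volume (fun _ ↦ volume) h.ne
      (lintegral_prod_le_BLconst_mul L hp)
    exact ⟨by simpa using this.scaling, this.dimension⟩
  · rintro ⟨hs, hd⟩
    have hcond : BLCond L p := ⟨hp, by simpa using hs, hd⟩
    obtain ⟨C, hC, h⟩ := hcond.blFinite hL volume fun _ ↦ volume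
    refine lt_of_le_of_lt (iSup_le fun f ↦ iSup_le fun hf ↦ iSup_le fun hf1 ↦ ?_) hC.lt_top
    simpa [hf1] using h f hf
end
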